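/- arXiv:math/0308124 — 2 statements merged into one kernel-verified Lean document; each statement's English description precedes it below -/
import Mathlib

section
/- In the zero-temperature Domany cellular automaton on the hexagonal lattice, if at some time n a site x belongs to a 'barbell' (two disjoint constant-sign simple loops joined by a constant-sign path, all of the same spin value), then the spin at x never flips at any later time. -/
variable {V : Type*}

/-- The majority value of the spins of the neighbors of `x` (true = +1). -/
def maj (G : SimpleGraph V) [G.LocallyFinite] (σ : V → Bool) (x : V) : Bool :=
  decide (2 ≤ ((G.neighborFinset x).filter (fun y => σ y = true)).card)

open Classical in
/-- The zero-temperature Domany dynamics: sites in `A` are updated (to the majority of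
their neighbors) at odd times, sites in `B` at even times. -/
noncomputable def domanyTraj (G : SimpleGraph V) [G.LocallyFinite] (A B : Set V)
    (σ0 : V → Bool) : ℕ → V → Bool
  | 0 => σ0
  | n + 1 => fun x =>
      if x ∈ (if (n + 1) % 2 = 1 then A else B) then
        maj G (domanyTraj G A B σ0 n) x
      else
        domanyTraj G A B σ0 n x

/-- A simple loop in the graph `G`. -/
def IsHLoop (G : SimpleGraph V) {k : ℕ} (c : ZMod k → V) : Prop :=
  3 ≤ k ∧ Function.Injective c ∧ ∀ i, G.Adj (c i) (c (i + 1))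

/-- A barbell of sign `s` (in configuration `σ`): two disjoint constant-sign simple loops
joined by a constant-sign simple path, all sites carrying the spin `s`. -/
def IsBarbell (G : SimpleGraph V) (σ : V → Bool) (s : Bool) (S : Set V) : Prop :=
  ∃ (k₁ k₂ : ℕ) (c₁ : ZMod k₁ → V) (c₂ : ZMod k₂ → V) (l : ℕ) (q : Fin (l + 1) → V),
    IsHLoop G c₁ ∧ IsHLoop G c₂ ∧ Disjoint (Set.range c₁) (Set.range c₂) ∧
    Function.Injective q ∧ (∀ i : Fin l, G.Adj (q i.castSucc) (q i.succ)) ∧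
    q 0 ∈ Set.range c₁ ∧ q (Fin.last l) ∈ Set.range c₂ ∧
    S = Set.range c₁ ∪ Set.range c₂ ∪ Set.range q ∧
    ∀ y ∈ S, σ y = s

/-- Every site of a simple loop has two distinct neighbors on the loop. -/
theorem IsHLoop.exists_two_adj {G : SimpleGraph V} {k : ℕ} {c : ZMod k → V} (h : IsHLoop G c)
    {y : V} (hy : y ∈ Set.range c) :
    ∃ a b, a ≠ b ∧ a ∈ Set.range c ∧ b ∈ Set.range c ∧ G.Adj y a ∧ G.Adj y b := by
  obtain ⟨hk, hinj, hadj⟩ := h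
  obtain ⟨i, rfl⟩ := hy
  refine ⟨c (i + 1), c (i - 1), ?_, ⟨_, rfl⟩, ⟨_, rfl⟩, hadj i, ?_⟩
  · intro hab
    have h2 : ((2 : ℕ) : ZMod k) = 0 := by
      push_cast
      linear_combination hinj hab
    have := Nat.le_of_dvd two_pos ((ZMod.natCast_eq_zero_iff 2 k).1 h2)
    omega
  · simpa using (hadj (i - 1)).symm

/-- Every site of a barbell has two distinct neighbors in the barbell. -/
theorem IsBarbell.exists_two_adj {G : SimpleGraph V} {σ : V → Bool} {s : Bool} {S : Set V}
    (h : IsBarbell G σ s S) {y : V} (hy : y ∈ S) :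
    ∃ a b, a ≠ b ∧ a ∈ S ∧ b ∈ S ∧ G.Adj y a ∧ G.Adj y b := by
  obtain ⟨k₁, k₂, c₁, c₂, l, q, h₁, h₂, -, hq, hqadj, hq0, hql, rfl, -⟩ := h
  have loop₁ : y ∈ Set.range c₁ → ∃ a b, a ≠ b ∧ a ∈ Set.range c₁ ∪ Set.range c₂ ∪ Set.range q ∧
      b ∈ Set.range c₁ ∪ Set.range c₂ ∪ Set.range q ∧ G.Adj y a ∧ G.Adj y b := fun hy ↦ by
    obtain ⟨a, b, hab, ha, hb, h⟩ := h₁.exists_two_adj hy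
    exact ⟨a, b, hab, .inl (.inl ha), .inl (.inl hb), h⟩
  have loop₂ : y ∈ Set.range c₂ → ∃ a b, a ≠ b ∧ a ∈ Set.range c₁ ∪ Set.range c₂ ∪ Set.range q ∧
      b ∈ Set.range c₁ ∪ Set.range c₂ ∪ Set.range q ∧ G.Adj y a ∧ G.Adj y b := fun hy ↦ by
    obtain ⟨a, b, hab, ha, hb, h⟩ := h₂.exists_two_adj hy
    exact ⟨a, b, hab, .inl (.inr ha), .inl (.inr hb), h⟩
  obtain (hy | hy) | ⟨⟨j, hj⟩, rfl⟩ := hy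
  · exact loop₁ hy
  · exact loop₂ hy
  · obtain rfl | hj0 := Nat.eq_zero_or_pos j
    · exact loop₁ hq0
    obtain rfl | hjl := eq_or_ne j l
    · exact loop₂ hql
    obtain ⟨i, rfl⟩ : ∃ i, j = i + 1 := ⟨j - 1, by omega⟩
    refine ⟨q ⟨i, by omega⟩, q ⟨i + 2, by omega⟩, fun hab ↦ ?_, .inr ⟨_, rfl⟩, .inr ⟨_, rfl⟩,
      (hqadj ⟨i, by omega⟩).symm, hqadj ⟨i + 1, by omega⟩⟩
    simpa using hq hab

/-- Two neighbors of equal spin decide the majority at a site of degree three. -/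
theorem maj_eq_of_two_adj {G : SimpleGraph V} [G.LocallyFinite] {σ : V → Bool} {s : Bool}
    {y a b : V} (hdeg : G.degree y = 3) (hab : a ≠ b) (ha : G.Adj y a) (hb : G.Adj y b)
    (hσa : σ a = s) (hσb : σ b = s) : maj G σ y = s := by
  classical
  have hcard : 2 ≤ ((G.neighborFinset y).filter (fun z ↦ σ z = s)).card := by
    rw [← Finset.card_pair hab]
    apply Finset.card_le_card
    intro z hz
    obtain rfl | rfl : z = a ∨ z = b := by simpa using hz
    · simp [ha, hσa]
    · simp [hb, hσb]
  unfold maj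
  cases s with
  | true => simpa using hcard
  | false =>
    have hsum := Finset.card_filter_add_card_filter_not
      (s := G.neighborFinset y) (fun z ↦ σ z = true)
    simp only [Bool.not_eq_true, G.card_neighborFinset_eq_degree, hdeg] at hsum
    exact decide_eq_false (by omega)

/-- In a cubic graph, a constant spin persists on a set in which every site has two neighbors. -/
theorem domanyTraj_eq_of_exists_two_adj {G : SimpleGraph V} [G.LocallyFinite] (A B : Set V)
    (σ0 : V → Bool) (hdeg : ∀ v, G.degree v = 3) {S : Set V} {s : Bool} {n : ℕ}
    (hS : ∀ y ∈ S, ∃ a b, a ≠ b ∧ a ∈ S ∧ b ∈ S ∧ G.Adj y a ∧ G.Adj y b)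
    (hs : ∀ y ∈ S, domanyTraj G A B σ0 n y = s) {m : ℕ} (hm : n ≤ m) :
    ∀ y ∈ S, domanyTraj G A B σ0 m y = s := by
  classical
  induction m, hm using Nat.le_induction with
  | base => exact hs
  | succ m _ ih =>
    intro y hy
    obtain ⟨a, b, hab, haS, hbS, ha, hb⟩ := hS y hy
    rw [domanyTraj, ite_eq_iff']
    exact ⟨fun _ ↦ maj_eq_of_two_adj (hdeg y) hab ha hb (ih a haS) (ih b hbS),
      fun _ ↦ ih y hy⟩

/-- if at time `n` the site `x` belongs to a barbell (two disjoint
constant-sign simple loops joined by a constant-sign path, all of the same spin value),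
then the spin at `x` never flips at any later time. -/
theorem domany_barbell_stable (G : SimpleGraph V) [G.LocallyFinite] (A B : Set V)
    (hdeg : ∀ v, G.degree v = 3)
    (hpart : ∀ v, v ∈ A ↔ v ∉ B)
    (hbip : ∀ ⦃x y⦄, G.Adj x y → (x ∈ A ↔ y ∈ B))
    (σ0 : V → Bool) (n : ℕ) (x : V)
    (hbarbell : ∃ (s : Bool) (S : Set V),
      IsBarbell G (domanyTraj G A B σ0 n) s S ∧ x ∈ S) :
    ∀ m, n ≤ m → domanyTraj G A B σ0 m x = domanyTraj G A B σ0 n x := by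
  obtain ⟨s, S, hS, hx⟩ := hbarbell
  have hs : ∀ y ∈ S, domanyTraj G A B σ0 n y = s := by
    obtain ⟨_, _, _, _, _, _, _, _, _, _, _, _, _, _, hs⟩ := hS
    exact hs
  intro m hm
  rw [hs x hx]
  exact domanyTraj_eq_of_exists_two_adj A B σ0 hdeg (fun _ ↦ hS.exists_two_adj) hs hm x hx
end

section
/- For the zero-temperature Domany model with initial Bernoulli(p) configuration, for every time n ∈ [1,∞] and every site x ∈ B, the percolation probability satisfies θ_x(p,n) ≥ p^6 · θ_x(p), where θ_x(p,n) is the probability that x lies in an infinite +1 H-path at time n, and θ_x(p) is the probability that x lies in an infinite +1 path in the triangular lattice B under the initial (time-0) configuration. -/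
open MeasureTheory

variable {V : Type*}

open Classical in
/-- The limiting configuration `σ^∞` of the Domany dynamics (the eventual value of each
spin, when it exists). -/
noncomputable def domanyLimit (G : SimpleGraph V) [G.LocallyFinite] (A B : Set V)
    (σ0 : V → Bool) (x : V) : Bool :=
  if h : ∃ b : Bool, ∀ᶠ m in Filter.atTop, domanyTraj G A B σ0 m x = b then h.choose
  else true

/-- The configuration at time `n ∈ [0,∞]`. -/
noncomputable def domanyTrajE (G : SimpleGraph V) [G.LocallyFinite] (A B : Set V)
    (σ0 : V → Bool) (n : ℕ∞) : V → Bool :=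
  n.recTopCoe (domanyLimit G A B σ0) (fun m => domanyTraj G A B σ0 m)

/-- The triangular-lattice adjacency on `B`: two `B`-sites are adjacent iff they are
distinct and at graph distance 2 in the hexagonal lattice (joined through an `A`-site). -/
def BAdj (G : SimpleGraph V) (A B : Set V) (x y : V) : Prop :=
  x ∈ B ∧ y ∈ B ∧ x ≠ y ∧ ∃ a ∈ A, G.Adj x a ∧ G.Adj a y

/-- `x` lies in an infinite open (= +1 = `true`) self-avoiding path for the adjacency
relation `R` in the configuration `ω`. -/
def InfOpenPathFromRel (R : V → V → Prop) (ω : V → Bool) (x : V) : Prop :=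
  ∃ γ : ℕ → V, Function.Injective γ ∧ γ 0 = x ∧
    (∀ n, R (γ n) (γ (n + 1))) ∧ ∀ n, ω (γ n) = true

/-- `x` and `y` are joined by an open (= +1 = `true`) self-avoiding path for the
adjacency relation `R` in the configuration `ω`. -/
def OpenConnRel (R : V → V → Prop) (ω : V → Bool) (x y : V) : Prop :=
  ∃ (k : ℕ) (γ : Fin (k + 1) → V), Function.Injective γ ∧ γ 0 = x ∧ γ (Fin.last k) = y ∧
    (∀ i : Fin k, R (γ i.castSucc) (γ i.succ)) ∧ ∀ i, ω (γ i) = true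

section NonBacktracking

/-- The dart `(u, v)` starts a non-backtracking walk of `Γ` with `k` further steps. -/
def LongFrom (Γ : SimpleGraph V) : ℕ → V → V → Prop
  | 0, _, _ => True
  | k + 1, u, v => ∃ z, Γ.Adj v z ∧ z ≠ u ∧ LongFrom Γ k v z

/-- The first `n` steps of `w` form a non-backtracking walk of `Γ`. -/
structure NBWalk (Γ : SimpleGraph V) (w : ℕ → V) (n : ℕ) : Prop where
  adj : ∀ i < n, Γ.Adj (w i) (w (i + 1))
  nb : ∀ i, i + 2 ≤ n → w i ≠ w (i + 2)

/-- The first `n` steps of `w` form a non-backtracking walk of `Γ` from `x`, starting into `J`. -/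
structure NBWalkInto (Γ : SimpleGraph V) (x : V) (J : Finset V) (w : ℕ → V) (n : ℕ) : Prop
    extends NBWalk Γ w n where
  start : w 0 = x
  first : 0 < n → w 1 ∈ J

variable {Γ Γ' : SimpleGraph V} {w w' : ℕ → V} {n m k : ℕ} {x : V} {J : Finset V}

lemma LongFrom.of_succ : ∀ {k : ℕ} {u v : V}, LongFrom Γ (k + 1) u v → LongFrom Γ k u v
  | 0, _, _, _ => trivial
  | _ + 1, _, _, ⟨z, hz, hne, h⟩ => ⟨z, hz, hne, h.of_succ⟩

lemma LongFrom.of_le {k l : ℕ} (hkl : k ≤ l) {u v : V} (h : LongFrom Γ l u v) :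
    LongFrom Γ k u v := by
  induction hkl with
  | refl => exact h
  | step _ ih => exact ih h.of_succ

lemma LongFrom.mono (hΓ : Γ ≤ Γ') : ∀ {k : ℕ} {u v : V}, LongFrom Γ k u v → LongFrom Γ' k u v
  | 0, _, _, _ => trivial
  | _ + 1, _, _, ⟨z, hz, hne, h⟩ => ⟨z, hΓ hz, hne, h.mono hΓ⟩

lemma NBWalk.of_le (h : NBWalk Γ w n) (hm : m ≤ n) : NBWalk Γ w m :=
  ⟨fun i hi => h.adj i (by omega), fun i hi => h.nb i (by omega)⟩

lemma NBWalkInto.of_le (h : NBWalkInto Γ x J w n) (hm : m ≤ n) : NBWalkInto Γ x J w m :=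
  ⟨h.toNBWalk.of_le hm, h.start, fun h0 => h.first (by omega)⟩

lemma NBWalkInto.congr (h : NBWalkInto Γ x J w n) (hw : ∀ i ≤ n, w' i = w i) :
    NBWalkInto Γ x J w' n := by
  refine ⟨⟨fun i hi => ?_, fun i hi => ?_⟩, ?_, fun h0 => ?_⟩
  · rw [hw i (by omega), hw (i + 1) (by omega)]; exact h.adj i hi
  · rw [hw i (by omega), hw (i + 2) (by omega)]; exact h.nb i hi
  · rw [hw 0 (by omega)]; exact h.start
  · rw [hw 1 (by omega)]; exact h.first h0

lemma NBWalk.longFrom (h : NBWalk Γ w (n + 1)) (hk : LongFrom Γ k (w n) (w (n + 1))) :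
    LongFrom Γ (k + n) (w 0) (w 1) := by
  induction n generalizing k with
  | zero => exact hk
  | succ n ih =>
    have := ih (k := k + 1) (h.of_le (by omega))
      ⟨w (n + 2), h.adj _ (by omega), (h.nb n (by omega)).symm, hk⟩
    rwa [show k + (n + 1) = k + 1 + n by omega]

/-- A closed non-backtracking walk extends to arbitrarily long ones. -/
lemma NBWalk.longFrom_of_closed (h : NBWalk Γ w (n + 1)) (hc : w (n + 1) = w 0) (k : ℕ) :
    LongFrom Γ k (w 0) (w 1) := by
  induction n using Nat.strong_induction_on generalizing w k with
  | _ n ih =>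
    by_cases hq : w 1 = w n
    · match n with
      | 0 => exact absurd hc.symm (h.adj 0 (by omega)).ne
      | 1 => exact absurd hc.symm (h.nb 0 (by omega))
      | 2 => exact absurd hq (h.adj 1 (by omega)).ne
      | m + 3 =>
        have := ih (m + 1) (by omega) (w := fun i => w (i + 1))
          ⟨fun i hi => h.adj (i + 1) (by omega), fun i hi => h.nb (i + 1) (by omega)⟩ hq.symm k
        exact LongFrom.of_succ ⟨w 2, h.adj 1 (by omega), (h.nb 0 (by omega)).symm, this⟩
    · induction k with
      | zero => trivial
      | succ k ihk =>
        have h1 : LongFrom Γ (k + 1) (w n) (w (n + 1)) := by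
          rw [hc]
          exact ⟨w 1, h.adj 0 (by omega), hq, ihk⟩
        exact (h.longFrom h1).of_le (by omega)

/-- If all non-backtracking walks from `x` into `J` are short, then such a walk is determined by
its last vertex. -/
lemma NBWalkInto.unique (hfail : ∀ a ∈ J, Γ.Adj x a → ¬ LongFrom Γ k x a)
    (h : NBWalkInto Γ x J w n) (h' : NBWalkInto Γ x J w' m) (hend : w n = w' m) :
    n = m ∧ ∀ i ≤ n, w i = w' i := by
  have key : ∀ {w : ℕ → V} {n : ℕ}, NBWalkInto Γ x J w (n + 1) → w (n + 1) ≠ x := by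
    intro w n h hx
    have h0 := h.start
    refine hfail (w 1) (h.first (by omega)) ?_ ?_
    · rw [← h0]; exact h.adj 0 (by omega)
    · rw [← h0]; exact h.toNBWalk.longFrom_of_closed (by rw [hx, h0]) k
  induction n generalizing m with
  | zero =>
    match m with
    | 0 => exact ⟨rfl, fun i hi => by rw [Nat.le_zero.1 hi, hend]⟩
    | m + 1 => exact absurd (hend.symm.trans h.start) (key h')
  | succ n ih =>
    match m with
    | 0 => exact absurd (hend.trans h'.start) (key h)
    | m + 1 =>
      by_cases hu : w n = w' m
      · obtain ⟨rfl, hw⟩ := ih (h.of_le (by omega)) (h'.of_le (by omega)) hu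
        refine ⟨rfl, fun i hi => ?_⟩
        rcases Nat.lt_or_ge i (n + 1) with hi' | hi'
        · exact hw i (by omega)
        · rw [show i = n + 1 by omega, hend]
      · exfalso
        set c : ℕ → V := fun i => if i ≤ n + 1 then w i else w' (n + 1 + (m + 1) - i) with hcdef
        have c1 : ∀ i ≤ n + 1, c i = w i := fun i hi => if_pos hi
        have c2 : ∀ i, n + 1 ≤ i → c i = w' (n + 1 + (m + 1) - i) := by
          intro i hi
          rcases hi.eq_or_lt with rfl | hi
          · rw [c1 _ le_rfl, hend]; congr 1; omega
          · exact if_neg (by omega)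
        have hclosed : NBWalkInto Γ x J c (n + 1 + m + 1) := by
          refine ⟨⟨fun i hi => ?_, fun i hi => ?_⟩, ?_, fun _ => ?_⟩
          · rcases Nat.lt_or_ge i (n + 1) with hi' | hi'
            · rw [c1 i (by omega), c1 (i + 1) (by omega)]; exact h.adj i hi'
            · rw [c2 i hi', c2 (i + 1) (by omega),
                show n + 1 + (m + 1) - i = (n + 1 + (m + 1) - (i + 1)) + 1 by omega]
              exact (h'.adj _ (by omega)).symm
          · rcases Nat.lt_trichotomy i n with hi' | rfl | hi'
            · rw [c1 i (by omega), c1 (i + 2) (by omega)]; exact h.nb i (by omega)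
            · rw [c1 i (by omega), c2 (i + 2) (by omega),
                show i + 1 + (m + 1) - (i + 2) = m by omega]
              exact hu
            · rw [c2 i hi', c2 (i + 2) (by omega),
                show n + 1 + (m + 1) - i = (n + 1 + (m + 1) - (i + 2)) + 2 by omega]
              exact (h'.nb _ (by omega)).symm
          · rw [c1 0 (by omega)]; exact h.start
          · rw [c1 1 (by omega)]; exact h.first (by omega)
        refine key hclosed ?_
        rw [c2 _ (by omega), show n + 1 + (m + 1) - (n + 1 + m + 1) = 0 by omega]
        exact h'.start

lemma NBWalkInto.length_le (hfail : ∀ a ∈ J, Γ.Adj x a → ¬ LongFrom Γ k x a)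
    (h : NBWalkInto Γ x J w n) : n ≤ k := by
  by_contra! hn
  obtain ⟨m, rfl⟩ : ∃ m, n = m + 1 := ⟨n - 1, by omega⟩
  have h1 : LongFrom Γ (0 + m) (w 0) (w 1) := h.toNBWalk.longFrom trivial
  have h2 := h.adj 0 (by omega)
  rw [h.start] at h1 h2
  exact hfail _ (h.first (by omega)) h2 (h1.of_le (by omega))

lemma NBWalkInto.snoc (h : NBWalkInto Γ x J w n) {c : V} (hc : Γ.Adj (w n) c)
    (h0 : n = 0 → c ∈ J) (hm : ∀ m, n = m + 1 → c ≠ w m) :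
    NBWalkInto Γ x J (fun i => if i ≤ n then w i else c) (n + 1) := by
  refine ⟨⟨fun i hi => ?_, fun i hi => ?_⟩, ?_, fun _ => ?_⟩
  · rcases Nat.lt_or_ge i n with hi' | hi'
    · simpa [hi'.le, Nat.succ_le_of_lt hi'] using h.adj i hi'
    · obtain rfl : i = n := by omega
      simpa using hc
  · rcases Nat.lt_or_ge (i + 1) n with hi' | hi'
    · simpa [show i ≤ n by omega, show i + 2 ≤ n by omega] using h.nb i (by omega)
    · obtain rfl : n = i + 1 := by omega
      simpa using (hm i rfl).symm
  · simpa using h.start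
  · rcases Nat.eq_zero_or_pos n with rfl | hn
    · simpa using h0 rfl
    · simpa [Nat.succ_le_of_lt hn] using h.first hn

/-- Arbitrarily long non-backtracking walks yield an infinite one. -/
lemma exists_nbWalk_of_longFrom [Γ.LocallyFinite] {u v : V} (huv : Γ.Adj u v)
    (h : ∀ k, LongFrom Γ k u v) : ∃ w : ℕ → V, w 0 = u ∧ w 1 = v ∧ ∀ n, NBWalk Γ w n := by
  have step : ∀ d : {d : V × V // Γ.Adj d.1 d.2 ∧ ∀ k, LongFrom Γ k d.1 d.2},
      ∃ z, z ≠ d.1.1 ∧ Γ.Adj d.1.2 z ∧ ∀ k, LongFrom Γ k d.1.2 z := by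
    rintro ⟨⟨u, v⟩, huv, h⟩
    by_contra! hcon
    have hz : ∀ z, ∃ k, z ≠ u → Γ.Adj v z → ¬ LongFrom Γ k v z := by
      intro z
      by_cases hz : z ≠ u ∧ Γ.Adj v z
      · obtain ⟨k, hk⟩ := hcon z hz.1 hz.2
        exact ⟨k, fun _ _ => hk⟩
      · exact ⟨0, fun h1 h2 => absurd ⟨h1, h2⟩ hz⟩
    choose K hK using hz
    obtain ⟨z, hvz, hzu, hl⟩ := h ((Γ.neighborFinset v).sup K + 1)
    exact hK z hzu hvz
      (hl.of_le (Finset.le_sup (f := K) ((Γ.mem_neighborFinset v z).2 hvz)))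
  choose z hz1 hz2 hz3 using step
  let d : ℕ → {d : V × V // Γ.Adj d.1 d.2 ∧ ∀ k, LongFrom Γ k d.1 d.2} :=
    fun n => n.rec ⟨(u, v), huv, h⟩ (fun _ e => ⟨(e.1.2, z e), hz2 e, hz3 e⟩)
  have hd : ∀ n, (d (n + 1)).1 = ((d n).1.2, z (d n)) := fun n => rfl
  have hd1 : ∀ n, (d (n + 1)).1.1 = (d n).1.2 := fun n => rfl
  refine ⟨fun n => (d n).1.1, rfl, rfl, fun n => ⟨fun i _ => ?_, fun i _ => ?_⟩⟩
  · exact (d i).2.1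
  · exact (hz1 (d i)).symm

end NonBacktracking


section PlusGraph

/-- The subgraph of `G` spanned by the darts whose endpoints in `A` have a plus majority. -/
def plusGraph (G : SimpleGraph V) [G.LocallyFinite] (A : Set V) (ω : V → Bool) :
    SimpleGraph V where
  Adj u v := G.Adj u v ∧ (u ∈ A → maj G ω u = true) ∧ (v ∈ A → maj G ω v = true)
  symm := ⟨fun _ _ h => ⟨h.1.symm, h.2.2, h.2.1⟩⟩
  loopless := ⟨fun _ h => h.1.ne rfl⟩

/-- A non-backtracking walk of `Γ` from `x` into `J` ends at `u` and could continue to `v`. -/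
def Frontier (Γ : SimpleGraph V) (x : V) (J : Finset V) (u v : V) : Prop :=
  ∃ (w : ℕ → V) (n : ℕ), NBWalkInto Γ x J w n ∧ w n = u ∧ (n = 0 → v ∈ J) ∧
    ∀ m, n = m + 1 → v ≠ w m

variable {Γ Γ' : SimpleGraph V} {x u u' v z : V} {J : Finset V} {k n : ℕ}

lemma Frontier.root (hv : v ∈ J) : Frontier Γ x J x v :=
  ⟨fun _ => x, 0, ⟨⟨fun i hi => absurd hi (by omega), fun i hi => absurd hi (by omega)⟩, rfl,
    fun h => absurd h (by omega)⟩, rfl, fun _ => hv, fun m hm => absurd hm (by omega)⟩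

lemma NBWalk.mono (hΓ : Γ ≤ Γ') {w : ℕ → V} (h : NBWalk Γ w n) : NBWalk Γ' w n :=
  ⟨fun i hi => hΓ (h.adj i hi), h.nb⟩

lemma Frontier.mono (hΓ : Γ ≤ Γ') (h : Frontier Γ x J u v) : Frontier Γ' x J u v := by
  obtain ⟨w, n, h1, h2⟩ := h
  exact ⟨w, n, ⟨h1.toNBWalk.mono hΓ, h1.start, h1.first⟩, h2⟩

lemma Frontier.exists_walk (h : Frontier Γ x J u v) (huv : Γ.Adj u v) :
    ∃ (w : ℕ → V) (n : ℕ), NBWalkInto Γ x J w (n + 1) ∧ w n = u ∧ w (n + 1) = v := by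
  obtain ⟨w, n, h1, rfl, h3, h4⟩ := h
  exact ⟨_, n, h1.snoc huv h3 h4, by simp, by simp⟩

lemma Frontier.snoc (h : Frontier Γ x J u v) (huv : Γ.Adj u v) (hz : z ≠ u) :
    Frontier Γ x J v z := by
  obtain ⟨w, n, h1, rfl, rfl⟩ := h.exists_walk huv
  refine ⟨w, n + 1, h1, rfl, fun h => absurd h (by omega), fun m hm => ?_⟩
  obtain rfl : n = m := by omega
  exact hz

lemma Frontier.eq_of_adj (hfail : ∀ a ∈ J, Γ.Adj x a → ¬ LongFrom Γ k x a)
    (h : Frontier Γ x J u v) (huv : Γ.Adj u v) (h' : Frontier Γ x J u' v) (hu'v : Γ.Adj u' v) :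
    u = u' := by
  obtain ⟨w, n, h1, rfl, h2⟩ := h.exists_walk huv
  obtain ⟨w', n', h1', rfl, h2'⟩ := h'.exists_walk hu'v
  obtain ⟨hn, hw⟩ := h1.unique hfail h1' (h2.trans h2'.symm)
  obtain rfl : n = n' := by omega
  exact hw n (by omega)

lemma Frontier.ne_start (hfail : ∀ a ∈ J, Γ.Adj x a → ¬ LongFrom Γ k x a)
    (h : Frontier Γ x J u v) (huv : Γ.Adj u v) : v ≠ x := by
  obtain ⟨w, n, h1, rfl, h2⟩ := h.exists_walk huv
  rintro rfl
  have := (h1.unique hfail (h1.of_le (Nat.zero_le _)) (h2.trans h1.start.symm)).1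
  omega

variable {G : SimpleGraph V} [G.LocallyFinite] {A : Set V} {ω ω' : V → Bool}

lemma maj_mono (hω : ∀ v, ω v = true → ω' v = true) (h : maj G ω u = true) :
    maj G ω' u = true := by
  simp only [maj, decide_eq_true_eq] at h ⊢
  exact h.trans (Finset.card_le_card (Finset.monotone_filter_right _ fun v _ hv => hω v hv))

lemma maj_congr (hω : ∀ v, G.Adj u v → ω v = ω' v) : maj G ω u = maj G ω' u := by
  unfold maj
  congr 3
  refine Finset.filter_congr fun v hv => ?_
  rw [hω v ((G.mem_neighborFinset u v).1 hv)]

lemma plusGraph_le : plusGraph G A ω ≤ G := fun _ _ h => h.1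

lemma plusGraph_mono (hω : ∀ v, ω v = true → ω' v = true) :
    plusGraph G A ω ≤ plusGraph G A ω' := fun _ _ h =>
  ⟨h.1, fun hu => maj_mono hω (h.2.1 hu), fun hv => maj_mono hω (h.2.2 hv)⟩

open Classical in
lemma exists_neighborFinset_eq (hdeg : ∀ v, G.degree v = 3) {a b : V} (h : G.Adj a b) :
    ∃ c d, b ≠ c ∧ b ≠ d ∧ c ≠ d ∧ G.neighborFinset a = {b, c, d} := by
  have h1 : ((G.neighborFinset a).erase b).card = 2 := by
    rw [Finset.card_erase_of_mem ((G.mem_neighborFinset a b).2 h), G.card_neighborFinset_eq_degree,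
      hdeg]
  obtain ⟨c, d, hcd, he⟩ := Finset.card_eq_two.1 h1
  refine ⟨c, d, ?_, ?_, hcd, ?_⟩
  · rintro rfl
    exact Finset.notMem_erase b (G.neighborFinset a) (he ▸ by simp)
  · rintro rfl
    exact Finset.notMem_erase b (G.neighborFinset a) (he ▸ by simp)
  · rw [← he, Finset.insert_erase ((G.mem_neighborFinset a b).2 h)]

open Classical in
lemma maj_eq_true_iff {a b c d : V} (hbc : b ≠ c) (hbd : b ≠ d) (hcd : c ≠ d)
    (h : G.neighborFinset a = {b, c, d}) :
    maj G ω a = true ↔ (ω b = true ∧ ω c = true) ∨ (ω b = true ∧ ω d = true) ∨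
      (ω c = true ∧ ω d = true) := by
  simp only [maj, decide_eq_true_eq, h]
  cases hb : ω b <;> cases hc : ω c <;> cases hd : ω d <;>
    simp [Finset.filter_insert, Finset.filter_singleton, hb, hc, hd, hbc, hbd, hcd]

/-- The dart `(b, a)` leaves a site `b` explored from `x` inside the plus graph of `ω`. -/
def Out (G : SimpleGraph V) [G.LocallyFinite] (A : Set V) (x : V) (J : Finset V) (ω : V → Bool)
    (b a : V) : Prop :=
  b ∉ A ∧ G.Adj b a ∧ Frontier (plusGraph G A ω) x J b a

variable {a b c : V}

lemma Out.mono (hω : ∀ v, ω v = true → ω' v = true) (h : Out G A x J ω b a) :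
    Out G A x J ω' b a :=
  ⟨h.1, h.2.1, h.2.2.mono (plusGraph_mono hω)⟩

lemma Out.mem (hA : ∀ ⦃u v⦄, G.Adj u v → (u ∈ A ↔ v ∉ A)) (h : Out G A x J ω b a) : a ∈ A := by
  have := hA h.2.1
  have := h.1
  tauto

lemma Out.adj (h : Out G A x J ω b a) (ha : maj G ω a = true) : (plusGraph G A ω).Adj b a :=
  ⟨h.2.1, fun hb => absurd hb h.1, fun _ => ha⟩

lemma plusGraph_adj_of_maj (hA : ∀ ⦃u v⦄, G.Adj u v → (u ∈ A ↔ v ∉ A)) (haA : a ∈ A)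
    (ha : maj G ω a = true) (hac : G.Adj a c) : (plusGraph G A ω).Adj a c :=
  ⟨hac, fun _ => ha, fun hc => absurd hc ((hA hac).1 haA)⟩

lemma Out.child (hA : ∀ ⦃u v⦄, G.Adj u v → (u ∈ A ↔ v ∉ A)) (h : Out G A x J ω b a)
    (ha : maj G ω a = true) (hac : G.Adj a c) (hcb : c ≠ b) (hcz : G.Adj c z) (hz : z ≠ a) :
    Out G A x J ω c z :=
  ⟨(hA hac).1 (h.mem hA), hcz, (h.2.2.snoc (h.adj ha) hcb).snoc
    (plusGraph_adj_of_maj hA (h.mem hA) ha hac) hz⟩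

lemma Out.child_ne_start (hA : ∀ ⦃u v⦄, G.Adj u v → (u ∈ A ↔ v ∉ A))
    (hfail : ∀ a ∈ J, (plusGraph G A ω).Adj x a → ¬ LongFrom (plusGraph G A ω) k x a)
    (h : Out G A x J ω b a) (ha : maj G ω a = true) (hac : G.Adj a c) (hcb : c ≠ b) : c ≠ x :=
  (h.2.2.snoc (h.adj ha) hcb).ne_start hfail (plusGraph_adj_of_maj hA (h.mem hA) ha hac)

/-- A child of an explored dart has at most one parent dart. -/
lemma Out.parent_unique (hA : ∀ ⦃u v⦄, G.Adj u v → (u ∈ A ↔ v ∉ A))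
    (hfail : ∀ a ∈ J, (plusGraph G A ω).Adj x a → ¬ LongFrom (plusGraph G A ω) k x a)
    {a' b' : V} (h : Out G A x J ω b a) (ha : maj G ω a = true) (hac : G.Adj a c) (hcb : c ≠ b)
    (h' : Out G A x J ω b' a') (ha' : maj G ω a' = true) (hac' : G.Adj a' c) (hcb' : c ≠ b') :
    a = a' ∧ b = b' := by
  have h1 := (h.2.2.snoc (h.adj ha) hcb).eq_of_adj hfail
    (plusGraph_adj_of_maj hA (h.mem hA) ha hac) (h'.2.2.snoc (h'.adj ha') hcb')
    (plusGraph_adj_of_maj hA (h'.mem hA) ha' hac')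
  subst h1
  refine ⟨rfl, ?_⟩
  have h2 := h'.adj ha'
  exact h.2.2.eq_of_adj hfail (h.adj ha) h'.2.2 h2

/-- Changing the spin of a child of an explored dart does not affect how the dart is explored. -/
lemma Out.of_eq_off_child (hA : ∀ ⦃u v⦄, G.Adj u v → (u ∈ A ↔ v ∉ A)) (hx : x ∉ A)
    (hfail : ∀ a ∈ J, (plusGraph G A ω).Adj x a → ¬ LongFrom (plusGraph G A ω) k x a)
    (h : Out G A x J ω b a) (ha : maj G ω a = true) (hac : G.Adj a c) (hcb : c ≠ b)
    (hω : ∀ v, v ≠ c → ω v = ω' v) : Out G A x J ω' b a := by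
  refine ⟨h.1, h.2.1, ?_⟩
  have hcx := h.child_ne_start hA hfail ha hac hcb
  have haA := h.mem hA
  have hcA := (hA hac).1 haA
  have hadj := h.adj ha
  have hac' := plusGraph_adj_of_maj hA haA ha hac
  obtain ⟨w, n, hw, rfl, h3, h4⟩ := h.2.2
  have hlong := (hw.snoc hadj h3 h4).snoc (c := c) (by simpa using hac') (by simp)
    (by intro m hm; obtain rfl : n = m := by omega
        simpa using hcb)
  have hmaj : ∀ i ≤ n, w i ∈ A → maj G ω (w i) = true ∧ ¬ G.Adj (w i) c := by
    intro i hi hiA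
    obtain ⟨j, rfl⟩ : ∃ j, i = j + 1 := by
      refine ⟨i - 1, ?_⟩
      have : i ≠ 0 := by
        rintro rfl
        exact hx (hw.start ▸ hiA)
      omega
    have hmj := (hw.adj j (by omega)).2.2 hiA
    refine ⟨hmj, fun hadjc => ?_⟩
    have hadjc' := plusGraph_adj_of_maj hA hiA hmj hadjc
    by_cases hcj : c = w j
    · have := (hlong.unique hfail (hw.of_le (show j ≤ n by omega)) (by simpa using hcj)).1
      omega
    · have hs := (hw.of_le hi).snoc hadjc' (by simp) (by
        intro m hm; obtain rfl : j = m := by omega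
        exact hcj)
      have := (hlong.unique hfail hs (by simp)).1
      omega
  refine ⟨w, n, ⟨⟨fun i hi => ⟨(hw.adj i hi).1, fun hi' => ?_, fun hi' => ?_⟩, hw.nb⟩, hw.start,
    hw.first⟩, rfl, h3, h4⟩
  · obtain ⟨h5, h6⟩ := hmaj i hi.le hi'
    rwa [← maj_congr fun v hv => hω v (by rintro rfl; exact h6 hv)]
  · obtain ⟨h5, h6⟩ := hmaj (i + 1) hi hi'
    rwa [← maj_congr fun v hv => hω v (by rintro rfl; exact h6 hv)]

open Classical in
/-- The ball of radius `k` around `x`. -/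
noncomputable def ballFinset (G : SimpleGraph V) [G.LocallyFinite] (x : V) : ℕ → Finset V
  | 0 => {x}
  | k + 1 => ballFinset G x k ∪ (ballFinset G x k).biUnion fun v => G.neighborFinset v

open Classical in
lemma ballFinset_mono : Monotone (ballFinset G x) :=
  monotone_nat_of_le_succ fun _ => Finset.subset_union_left

lemma mem_ballFinset_succ (hu : u ∈ ballFinset G x k) (huv : G.Adj u v) :
    v ∈ ballFinset G x (k + 1) := by
  classical
  exact Finset.mem_union_right _
    (Finset.mem_biUnion.2 ⟨u, hu, (G.mem_neighborFinset u v).2 huv⟩)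

lemma Out.mem_ballFinset
    (hfail : ∀ a ∈ J, (plusGraph G A ω).Adj x a → ¬ LongFrom (plusGraph G A ω) k x a)
    (h : Out G A x J ω b a) : b ∈ ballFinset G x k ∧ a ∈ ballFinset G x (k + 1) := by
  obtain ⟨-, hba, w, n, hw, rfl, -⟩ := h
  have hmem : ∀ i ≤ n, w i ∈ ballFinset G x i := by
    intro i hi
    induction i with
    | zero => rw [hw.start]; exact Finset.mem_singleton_self x
    | succ i ih => exact mem_ballFinset_succ (ih (by omega)) (hw.adj i hi).1
  have := ballFinset_mono (G := G) (x := x) (hw.length_le hfail) (hmem n le_rfl)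
  exact ⟨this, mem_ballFinset_succ this hba⟩

end PlusGraph

section BernoulliSum

open Classical in
/-- The expectation of `φ` under the Bernoulli(`p`) product measure on the subsets of `W`. -/
noncomputable def bernoulliSum (p : ℝ) (W : Finset V) (φ : Finset V → ℝ) : ℝ :=
  ∑ T ∈ W.powerset, p ^ T.card * (1 - p) ^ (W \ T).card * φ T

variable {p : ℝ} {W : Finset V} {y : V} {φ ψ f g : Finset V → ℝ}

lemma bernoulliSum_empty : bernoulliSum p ∅ φ = φ ∅ := by simp [bernoulliSum]

open Classical in
lemma bernoulliSum_insert (hy : y ∉ W) : bernoulliSum p (insert y W) φ =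
    (1 - p) * bernoulliSum p W φ + p * bernoulliSum p W (fun T => φ (insert y T)) := by
  unfold bernoulliSum
  rw [Finset.sum_powerset_insert hy, Finset.mul_sum, Finset.mul_sum]
  congr 1 <;> refine Finset.sum_congr rfl fun T hT => ?_
  · have hyT : y ∉ T := fun h => hy (Finset.mem_powerset.1 hT h)
    rw [Finset.insert_sdiff_of_notMem _ hyT, Finset.card_insert_of_notMem (by simp [hy])]
    ring
  · have hyT : y ∉ T := fun h => hy (Finset.mem_powerset.1 hT h)
    rw [Finset.card_insert_of_notMem hyT, Finset.insert_sdiff_insert,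
      Finset.sdiff_insert_of_notMem hy]
    ring

lemma bernoulliSum_congr (h : ∀ T ⊆ W, φ T = ψ T) : bernoulliSum p W φ = bernoulliSum p W ψ :=
  Finset.sum_congr rfl fun T hT => by rw [h T (Finset.mem_powerset.1 hT)]

lemma bernoulliSum_mono (hp0 : 0 ≤ p) (hp1 : p ≤ 1) (h : ∀ T ⊆ W, φ T ≤ ψ T) :
    bernoulliSum p W φ ≤ bernoulliSum p W ψ := by
  refine Finset.sum_le_sum fun T hT => ?_
  have : 0 ≤ 1 - p := by linarith
  exact mul_le_mul_of_nonneg_left (h T (Finset.mem_powerset.1 hT)) (by positivity)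

lemma bernoulliSum_add : bernoulliSum p W (fun T => φ T + ψ T) =
    bernoulliSum p W φ + bernoulliSum p W ψ := by
  simp only [bernoulliSum, mul_add, Finset.sum_add_distrib]

lemma bernoulliSum_mul_left (c : ℝ) : bernoulliSum p W (fun T => c * φ T) =
    c * bernoulliSum p W φ := by
  simp only [bernoulliSum, Finset.mul_sum]
  exact Finset.sum_congr rfl fun T _ => by ring

lemma bernoulliSum_sub : bernoulliSum p W (fun T => φ T - ψ T) =
    bernoulliSum p W φ - bernoulliSum p W ψ := by
  simp only [bernoulliSum, mul_sub, Finset.sum_sub_distrib]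

lemma bernoulliSum_sum {ι : Type*} (s : Finset ι) (Φ : ι → Finset V → ℝ) :
    bernoulliSum p W (fun T => ∑ i ∈ s, Φ i T) = ∑ i ∈ s, bernoulliSum p W (Φ i) := by
  simp only [bernoulliSum, Finset.mul_sum]
  exact Finset.sum_comm

lemma bernoulliSum_const (c : ℝ) : bernoulliSum p W (fun _ => c) = c := by
  classical
  induction W using Finset.induction_on with
  | empty => exact bernoulliSum_empty
  | insert y W hy ih =>
    rw [bernoulliSum_insert hy, ih]
    ring

/-- The Harris inequality. -/
lemma bernoulliSum_mul_le (hp0 : 0 ≤ p) (hp1 : p ≤ 1) (hf : Monotone f) (hg : Monotone g) :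
    bernoulliSum p W f * bernoulliSum p W g ≤ bernoulliSum p W (fun T => f T * g T) := by
  classical
  induction W using Finset.induction_on generalizing f g with
  | empty => simp [bernoulliSum_empty]
  | insert y W hy ih =>
    have hi : Monotone (fun T : Finset V => insert y T) := fun _ _ h => Finset.insert_subset_insert y h
    have h0 := ih hf hg
    have h1 := ih (hf.comp hi) (hg.comp hi)
    have hf1 := bernoulliSum_mono (W := W) hp0 hp1 fun T _ => hf (Finset.subset_insert y T)
    have hg1 := bernoulliSum_mono (W := W) hp0 hp1 fun T _ => hg (Finset.subset_insert y T)
    simp only [bernoulliSum_insert hy]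
    simp only [Function.comp_def] at h0 h1
    set a := bernoulliSum p W f
    set b := bernoulliSum p W g
    set c := bernoulliSum p W fun T => f (insert y T)
    set d := bernoulliSum p W fun T => g (insert y T)
    have hq : 0 ≤ 1 - p := by linarith
    have h2 := mul_nonneg (mul_nonneg hp0 hq)
      (mul_nonneg (sub_nonneg.2 hf1) (sub_nonneg.2 hg1))
    have h3 := mul_le_mul_of_nonneg_left h0 hq
    have h4 := mul_le_mul_of_nonneg_left h1 hp0
    nlinarith

open Classical in
/-- The derivative of an expectation in terms of covariances. -/
lemma exists_hasDerivAt_bernoulliSum (p : ℝ) (W : Finset V) (φ : Finset V → ℝ) :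
    ∃ D, HasDerivAt (fun q => bernoulliSum q W φ) D p ∧ p * (1 - p) * D =
      ∑ y ∈ W, bernoulliSum p W (fun T => ((if y ∈ T then 1 else 0) - p) * φ T) := by
  induction W using Finset.induction_on generalizing φ with
  | empty =>
    exact ⟨0, by simpa [bernoulliSum_empty] using hasDerivAt_const p (φ ∅), by simp⟩
  | insert z W hz ih =>
    obtain ⟨D0, h0, e0⟩ := ih φ
    obtain ⟨D1, h1, e1⟩ := ih (fun T => φ (insert z T))
    refine ⟨(-1) * bernoulliSum p W φ + (1 - p) * D0 +
      (1 * bernoulliSum p W (fun T => φ (insert z T)) + p * D1), ?_, ?_⟩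
    · simp only [bernoulliSum_insert hz]
      exact (((hasDerivAt_id p).const_sub 1).mul h0).add ((hasDerivAt_id p).mul h1)
    · rw [Finset.sum_insert hz]
      simp only [bernoulliSum_insert hz, Finset.sum_add_distrib, ← Finset.mul_sum]
      rw [← e0]
      have e2 : ∀ y ∈ W, bernoulliSum p W
          (fun T => ((if y ∈ insert z T then 1 else 0) - p) * φ (insert z T)) =
          bernoulliSum p W (fun T => ((if y ∈ T then 1 else 0) - p) * φ (insert z T)) := by
        intro y hy
        have hyz : y ≠ z := by rintro rfl; exact hz hy
        simp [Finset.mem_insert, hyz]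
      rw [Finset.sum_congr rfl e2, ← e1]
      have e3 : bernoulliSum p W (fun T => ((if z ∈ T then 1 else 0) - p) * φ T) =
          -p * bernoulliSum p W φ := by
        rw [← bernoulliSum_mul_left]
        refine bernoulliSum_congr fun T hT => ?_
        have : z ∉ T := fun h => hz (hT h)
        simp [this]
      have e4 : bernoulliSum p W
          (fun T => ((if z ∈ insert z T then 1 else 0) - p) * φ (insert z T)) =
          (1 - p) * bernoulliSum p W (fun T => φ (insert z T)) := by
        rw [← bernoulliSum_mul_left]
        simp
      rw [e3, e4]
      ring

open Classical in
/-- For a decreasing event `F`, if `m` does not depend on `y` and is at most `C` on `F` without `y`,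
then replacing `m` by `C` increases its covariance with the vacancy of `y` on `F`. -/
lemma bernoulliSum_le_of_le (hp0 : 0 ≤ p) (hp1 : p ≤ 1) {F : Finset V → Prop} [DecidablePred F]
    {m : Finset V → ℝ}
    {C : ℝ} (hy : y ∈ W) (hF : ∀ T, F (insert y T) → F T) (hm : ∀ T, y ∉ T → m (insert y T) = m T)
    (hC : ∀ T, F T → y ∉ T → m T ≤ C) :
    bernoulliSum p W (fun T => if F T then (p - if y ∈ T then 1 else 0) * m T else 0) ≤
      C * bernoulliSum p W (fun T => if F T then p - (if y ∈ T then 1 else 0) else 0) := by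
  obtain ⟨W, hyW, rfl⟩ : ∃ W', y ∉ W' ∧ W = insert y W' :=
    ⟨W.erase y, Finset.notMem_erase y W, (Finset.insert_erase hy).symm⟩
  rw [bernoulliSum_insert hyW, bernoulliSum_insert hyW, mul_add, mul_left_comm C, mul_left_comm C]
  simp only [← bernoulliSum_mul_left, ← bernoulliSum_add]
  refine bernoulliSum_mono hp0 hp1 fun T hT => ?_
  have hyT : y ∉ T := fun h => hyW (hT h)
  have hpq : 0 ≤ p * (1 - p) := mul_nonneg hp0 (by linarith)
  have h1 := hF T
  have h2 := hC T
  simp only [hyT, Finset.mem_insert_self, if_true, if_false, hm T hyT]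
  by_cases ha : F T
  · have h3 := mul_le_mul_of_nonneg_left (h2 ha hyT) hpq
    by_cases hb : F (insert y T)
    · simp only [ha, hb, if_true]
      nlinarith
    · simp only [ha, hb, if_true, if_false]
      nlinarith
  · have hb : ¬ F (insert y T) := fun h => ha (h1 h)
    simp [ha, hb]

end BernoulliSum

section Exchange

set_option linter.unusedSimpArgs false

open Classical

variable {G : SimpleGraph V} [G.LocallyFinite] {A : Set V} {x : V} {J : Finset V} {k : ℕ}
  {p v κ r : ℝ} {T W : Finset V} {a b c d y : V} {ω : V → Bool}

/-- The configuration whose open sites are `x` and the elements of `T`. -/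
noncomputable def plusConfig (x : V) (T : Finset V) : V → Bool := fun u => decide (u = x ∨ u ∈ T)

/-- Some non-backtracking walk of the plus graph starts at `x` into `J` and has `k + 1` steps. -/
def Escapes (G : SimpleGraph V) [G.LocallyFinite] (A : Set V) (x : V) (J : Finset V) (k : ℕ)
    (ω : V → Bool) : Prop :=
  ∃ a ∈ J, (plusGraph G A ω).Adj x a ∧ LongFrom (plusGraph G A ω) k x a

/-- The weight of a dart whose source has spin `s` and whose other child has spin `e`. -/
noncomputable def exchangeWeight (p v κ : ℝ) (s e : Bool) : ℝ :=
  if s then 2 + 2 * v - 2 * v * ((if e then 1 else 0) + p) else 2 * κ * ((if e then 1 else 0) + p)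

/-- The weight attached to the dart `(b, a)` with children `c` and `d`, explored without `c`. -/
noncomputable def exchangeTerm (G : SimpleGraph V) [G.LocallyFinite] (A : Set V) (x : V)
    (J : Finset V) (p v κ : ℝ) (T : Finset V) (b a c d : V) : ℝ :=
  if Out G A x J (plusConfig x (T.erase c)) b a then
    exchangeWeight p v κ (plusConfig x T b) (plusConfig x T d) else 0

/-- The sum of the weights of the explored darts having `y` as a child. -/
noncomputable def exchangeSum (G : SimpleGraph V) [G.LocallyFinite] (A : Set V) (x : V)
    (J : Finset V) (p v κ : ℝ) (k : ℕ) (T : Finset V) (y : V) : ℝ :=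
  ∑ q ∈ (ballFinset G x (k + 1) ×ˢ ballFinset G x (k + 1)).filter (fun q => G.Adj q.1 q.2),
    if y ∈ (G.neighborFinset q.2).erase q.1 then
      ∑ d ∈ ((G.neighborFinset q.2).erase q.1).erase y, exchangeTerm G A x J p v κ T q.1 q.2 y d
    else 0

lemma not_escapes_iff : ¬ Escapes G A x J k ω ↔
    ∀ a ∈ J, (plusGraph G A ω).Adj x a → ¬ LongFrom (plusGraph G A ω) k x a := by
  simp [Escapes]

lemma Escapes.mono {ω' : V → Bool} (hω : ∀ v, ω v = true → ω' v = true)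
    (h : Escapes G A x J k ω) : Escapes G A x J k ω' := by
  obtain ⟨a, ha, h1, h2⟩ := h
  exact ⟨a, ha, plusGraph_mono hω h1, h2.mono (plusGraph_mono hω)⟩

lemma plusConfig_mono {T' : Finset V} (h : T ⊆ T') (u : V) (hu : plusConfig x T u = true) :
    plusConfig x T' u = true := by
  simp only [plusConfig, decide_eq_true_eq] at hu ⊢
  exact hu.imp_right fun hu => h hu

lemma exchangeWeight_nonneg (hp0 : 0 ≤ p) (hp1 : p ≤ 1) (hv0 : 0 ≤ v) (hκ0 : 0 ≤ κ)
    (hv1 : v ≤ 1) (s e : Bool) : 0 ≤ exchangeWeight p v κ s e := by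
  unfold exchangeWeight
  have := mul_le_one₀ hv1 hp0 hp1
  cases s <;> cases e <;> simp <;> first | positivity | nlinarith

lemma exchangeTerm_nonneg (hp0 : 0 ≤ p) (hp1 : p ≤ 1) (hv0 : 0 ≤ v) (hκ0 : 0 ≤ κ)
    (hv1 : v ≤ 1) : 0 ≤ exchangeTerm G A x J p v κ T b a c d := by
  unfold exchangeTerm
  split_ifs
  · exact exchangeWeight_nonneg hp0 hp1 hv0 hκ0 hv1 _ _
  · exact le_rfl

lemma exchangeTerm_eq_zero (h : ¬ Out G A x J (plusConfig x T) b a) :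
    exchangeTerm G A x J p v κ T b a c d = 0 :=
  if_neg fun h' => h (h'.mono (plusConfig_mono (Finset.erase_subset c T)))

/-- The exchange terms of an explored dart are dominated by the number of its grandchildren. -/
lemma exchangeTerm_add_le (hA : ∀ ⦃u v⦄, G.Adj u v → (u ∈ A ↔ v ∉ A)) (hx : x ∉ A)
    (hp0 : 0 ≤ p) (hp1 : p ≤ 1) (hκ0 : 0 ≤ κ) (hκ1 : κ ≤ 1)
    (hfail : ¬ Escapes G A x J k (plusConfig x T)) (h : Out G A x J (plusConfig x T) b a)
    (hbc : b ≠ c) (hbd : b ≠ d) (hcd : c ≠ d) (hN : G.neighborFinset a = {b, c, d}) :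
    (if c = x then 0 else
        ((if c ∈ T then 1 else 0) - p) * exchangeTerm G A x J p v κ T b a c d) +
      (if d = x then 0 else
        ((if d ∈ T then 1 else 0) - p) * exchangeTerm G A x J p v κ T b a d c) ≤
    (if maj G (plusConfig x T) a = true then
      2 * (if plusConfig x T c then 1 else v) + 2 * (if plusConfig x T d then 1 else v) else 0) -
      (if plusConfig x T b then 4 * p * (1 + v * (1 - p)) else 4 * κ * p ^ 2) := by
  rw [not_escapes_iff] at hfail
  have hac : G.Adj a c := (G.mem_neighborFinset a c).1 (by simp [hN])
  have had : G.Adj a d := (G.mem_neighborFinset a d).1 (by simp [hN])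
  have hoff : ∀ e, ∀ u, u ≠ e → plusConfig x T u = plusConfig x (T.erase e) u := by
    intro e u hu
    simp [plusConfig, hu]
  have hm := maj_eq_true_iff (ω := plusConfig x T) hbc hbd hcd hN
  have hPc : maj G (plusConfig x T) a = true → c ≠ x ∧ Out G A x J (plusConfig x (T.erase c)) b a :=
    fun hm => ⟨h.child_ne_start hA hfail hm hac hbc.symm,
      h.of_eq_off_child hA hx hfail hm hac hbc.symm (hoff c)⟩
  have hPd : maj G (plusConfig x T) a = true → d ≠ x ∧ Out G A x J (plusConfig x (T.erase d)) b a :=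
    fun hm => ⟨h.child_ne_start hA hfail hm had hbd.symm,
      h.of_eq_off_child hA hx hfail hm had hbd.symm (hoff d)⟩
  have hQ : ∀ e, e ∉ T → Out G A x J (plusConfig x (T.erase e)) b a := fun e he => by
    rwa [Finset.erase_eq_of_notMem he]
  have hQc := hQ c
  have hQd := hQ d
  have hcT : plusConfig x T c = true ↔ c = x ∨ c ∈ T := by simp [plusConfig]
  have hdT : plusConfig x T d = true ↔ d = x ∨ d ∈ T := by simp [plusConfig]
  have hpp : 0 ≤ κ * p := mul_nonneg hκ0 hp0
  have h1p : 0 ≤ 1 - p := by linarith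
  have hpp1 : 0 ≤ κ * p * (1 - p) := mul_nonneg hpp h1p
  have hkk : 0 ≤ 1 - κ := by linarith
  unfold exchangeTerm exchangeWeight
  clear hoff hQ h hN
  cases hb : plusConfig x T b <;> cases hc : plusConfig x T c <;> cases hd : plusConfig x T d <;>
    simp only [hb, hc, hd, Bool.false_eq_true, false_and, and_false, or_false, and_true,
      true_and, or_true, iff_true, false_or, true_iff, false_iff, iff_false, not_or] at hm hcT hdT <;>
    simp only [hm, forall_const, true_implies] at hPc hPd ⊢
  all_goals
    by_cases hcx : c = x <;> by_cases hcT' : c ∈ T <;> by_cases hdx : d = x <;>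
      by_cases hdT' : d ∈ T <;>
      simp only [hcx, hdx, hcT', hdT', if_true, if_false, Bool.false_eq_true, ne_eq, not_true,
        not_false_iff, true_and, false_and, forall_const, or_false, or_true, and_self,
        not_false_eq_true, and_true, and_false, false_or, true_or] at hQc hQd hPc hPd hcT hdT ⊢
  all_goals first
    | exact hcT.elim
    | exact hdT.elim
    | exact absurd (hcx.trans hdx.symm) hcd
    | (split_ifs <;> nlinarith)

/-- The explored darts, with the spin of their source counted as `1` or `v`, outnumber by two
those among them that are grandchildren of the start. -/
lemma sum_out_grandchildren_add_two_le (hA : ∀ ⦃u v⦄, G.Adj u v → (u ∈ A ↔ v ∉ A)) (hx : x ∉ A)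
    (hJ : J ⊆ G.neighborFinset x) (hJ2 : J.card = 2) (hv0 : 0 ≤ v)
    (hfail : ¬ Escapes G A x J k ω) (hωx : ω x = true) {D Y : Finset (V × V)}
    (hD : D = (ballFinset G x (k + 1) ×ˢ ballFinset G x (k + 1)).filter
      (fun q => G.Adj q.1 q.2)) (hY : Y = D.filter (fun q => Out G A x J ω q.1 q.2)) :
    ∑ q ∈ Y, (∑ e ∈ Y, if maj G ω q.2 = true ∧ G.Adj q.2 e.1 ∧ e.1 ≠ q.1 ∧ e.2 ≠ q.2 then
      (if ω e.1 then 1 else v) else 0) + 2 ≤ ∑ q ∈ Y, (if ω q.1 then 1 else v) := by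
  rw [not_escapes_iff] at hfail
  have hYmem : ∀ q, q ∈ Y ↔ Out G A x J ω q.1 q.2 := by
    intro q
    rw [hY, hD]
    simp only [Finset.mem_filter, Finset.mem_product, and_iff_right_iff_imp]
    intro h
    have := h.mem_ballFinset hfail
    exact ⟨⟨ballFinset_mono (Nat.le_succ k) this.1, this.2⟩, h.2.1⟩
  have hw : ∀ u, 0 ≤ (if ω u = true then 1 else v) := by
    intro u
    split_ifs <;> linarith
  rw [Finset.sum_comm, ← Finset.sum_filter_add_sum_filter_not Y (fun e => e.1 = x)
    (fun q => if ω q.1 = true then 1 else v), add_comm]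
  refine add_le_add ?_ ?_
  · have hsub : J.image (fun a => (x, a)) ⊆ Y.filter (fun e => e.1 = x) := by
      intro e he
      obtain ⟨a, ha, rfl⟩ := Finset.mem_image.1 he
      exact Finset.mem_filter.2 ⟨(hYmem _).2 ⟨hx, (G.mem_neighborFinset x a).1 (hJ ha),
        Frontier.root ha⟩, rfl⟩
    refine le_trans (le_of_eq ?_) (Finset.sum_le_sum_of_subset_of_nonneg hsub
      fun e _ _ => hw e.1)
    rw [Finset.sum_image (by simp), Finset.sum_congr rfl (fun a _ => if_pos hωx)]
    simp [hJ2]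
  · rw [Finset.sum_filter]
    refine Finset.sum_le_sum fun e he => ?_
    rw [← Finset.sum_filter, Finset.sum_const, nsmul_eq_mul]
    by_cases hex : e.1 = x
    · rw [Finset.filter_eq_empty_iff.2, if_neg (c := ¬ e.1 = x) (not_not.2 hex)]
      · simp
      · rintro q hq ⟨h1, h2, h3, -⟩
        exact ((hYmem q).1 hq).child_ne_start hA hfail h1 h2 h3 hex
    · rw [if_pos hex]
      refine mul_le_of_le_one_left (hw e.1) ?_
      norm_cast
      refine Finset.card_le_one.2 fun q hq q' hq' => ?_
      obtain ⟨hq, h1, h2, h3, -⟩ := Finset.mem_filter.1 hq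
      obtain ⟨hq', h1', h2', h3', -⟩ := Finset.mem_filter.1 hq'
      obtain ⟨h4, h5⟩ := ((hYmem q).1 hq).parent_unique hA hfail h1 h2 h3 ((hYmem q').1 hq') h1' h2' h3'
      exact Prod.ext h5 h4

lemma le_sum_out_grandchildren (hdeg : ∀ v, G.degree v = 3)
    (hA : ∀ ⦃u v⦄, G.Adj u v → (u ∈ A ↔ v ∉ A)) (hv0 : 0 ≤ v)
    {Y : Finset (V × V)} (hY : ∀ q : V × V, Out G A x J ω q.1 q.2 → q ∈ Y)
    (h : Out G A x J ω b a) (hbc : b ≠ c) (hbd : b ≠ d) (hcd : c ≠ d)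
    (hN : G.neighborFinset a = {b, c, d}) :
    (if maj G ω a = true then
      2 * (if ω c then 1 else v) + 2 * (if ω d then 1 else v) else 0) ≤
    ∑ e ∈ Y, if maj G ω a = true ∧ G.Adj a e.1 ∧ e.1 ≠ b ∧ e.2 ≠ a then
      (if ω e.1 then 1 else v) else 0 := by
  have hw : ∀ u, 0 ≤ (if ω u = true then 1 else v) := by
    intro u
    split_ifs <;> linarith
  by_cases hm : maj G ω a = true
  swap
  · simp [hm]
  have hac : G.Adj a c := (G.mem_neighborFinset a c).1 (by simp [hN])
  have had : G.Adj a d := (G.mem_neighborFinset a d).1 (by simp [hN])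
  obtain ⟨c1, c2, h1, h2, h3, hc⟩ := exists_neighborFinset_eq hdeg hac.symm
  obtain ⟨d1, d2, h4, h5, h6, hd⟩ := exists_neighborFinset_eq hdeg had.symm
  have hcz : ∀ z, z = c1 ∨ z = c2 → G.Adj c z := fun z hz =>
    (G.mem_neighborFinset c z).1 (by rw [hc]; simp [hz])
  have hdz : ∀ z, z = d1 ∨ z = d2 → G.Adj d z := fun z hz =>
    (G.mem_neighborFinset d z).1 (by rw [hd]; simp [hz])
  rw [if_pos hm, ← Finset.sum_filter]
  have hsub : ({(c, c1), (c, c2), (d, d1), (d, d2)} : Finset (V × V)) ⊆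
      Y.filter (fun e => maj G ω a = true ∧ G.Adj a e.1 ∧ e.1 ≠ b ∧ e.2 ≠ a) := by
    intro e he
    simp only [Finset.mem_insert, Finset.mem_singleton] at he
    refine Finset.mem_filter.2 ⟨hY e ?_, hm, ?_⟩
    · rcases he with rfl | rfl | rfl | rfl
      · exact h.child hA hm hac hbc.symm (hcz _ (Or.inl rfl)) h1.symm
      · exact h.child hA hm hac hbc.symm (hcz _ (Or.inr rfl)) h2.symm
      · exact h.child hA hm had hbd.symm (hdz _ (Or.inl rfl)) h4.symm
      · exact h.child hA hm had hbd.symm (hdz _ (Or.inr rfl)) h5.symm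
    · rcases he with rfl | rfl | rfl | rfl
      · exact ⟨hac, hbc.symm, h1.symm⟩
      · exact ⟨hac, hbc.symm, h2.symm⟩
      · exact ⟨had, hbd.symm, h4.symm⟩
      · exact ⟨had, hbd.symm, h5.symm⟩
  refine le_trans (le_of_eq ?_) (Finset.sum_le_sum_of_subset_of_nonneg hsub fun e _ _ => hw e.1)
  rw [Finset.sum_insert, Finset.sum_insert, Finset.sum_insert, Finset.sum_singleton]
  · ring
  all_goals simp [h3, h6, hcd]

lemma sum_exchangeTerm_eq (hbc : b ≠ c) (hbd : b ≠ d) (hcd : c ≠ d)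
    (hN : G.neighborFinset a = {b, c, d}) (hxW : x ∉ W) (hc : c ≠ x → c ∈ W)
    (hd : d ≠ x → d ∈ W) :
    ∑ y ∈ W, ((if y ∈ T then 1 else 0) - p) * (if y ∈ (G.neighborFinset a).erase b then
      ∑ d ∈ ((G.neighborFinset a).erase b).erase y, exchangeTerm G A x J p v κ T b a y d else 0) =
    (if c = x then 0 else
        ((if c ∈ T then 1 else 0) - p) * exchangeTerm G A x J p v κ T b a c d) +
      (if d = x then 0 else
        ((if d ∈ T then 1 else 0) - p) * exchangeTerm G A x J p v κ T b a d c) := by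
  have he : (G.neighborFinset a).erase b = {c, d} := by
    rw [hN, Finset.erase_insert (by simp [hbc, hbd])]
  have h1 : (({c, d} : Finset V).erase c) = {d} := Finset.erase_insert (by simpa using hcd)
  have h2 : (({c, d} : Finset V).erase d) = {c} := by
    rw [Finset.pair_comm]; exact Finset.erase_insert (by simpa using hcd.symm)
  rw [he]
  have h3 : ∀ F : V → ℝ, (∀ y, y ≠ c → y ≠ d → F y = 0) →
      ∑ y ∈ W, F y = (if c = x then 0 else F c) + (if d = x then 0 else F d) := by
    intro F hF
    have h4 : ∑ y ∈ W, F y = ∑ y ∈ ({c, d} : Finset V), if y = x then 0 else F y := by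
      rw [← Finset.sum_filter_add_sum_filter_not W (fun y => y = c ∨ y = d),
        Finset.sum_eq_zero (s := W.filter fun y => ¬ (y = c ∨ y = d)), add_zero,
        ← Finset.sum_filter_add_sum_filter_not {c, d} (fun y => y = x),
        Finset.sum_eq_zero (s := Finset.filter (fun y => y = x) _), zero_add]
      · refine Finset.sum_congr ?_ fun y hy => ?_
        · ext y
          simp only [Finset.mem_filter, Finset.mem_insert, Finset.mem_singleton]
          constructor
          · rintro ⟨hy, h⟩
            exact ⟨h, fun hyx => hxW (hyx ▸ hy)⟩
          · rintro ⟨rfl | rfl, h⟩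
            · exact ⟨hc h, Or.inl rfl⟩
            · exact ⟨hd h, Or.inr rfl⟩
        · rw [if_neg (Finset.mem_filter.1 hy).2]
      · intro y hy
        rw [if_pos (Finset.mem_filter.1 hy).2]
      · intro y hy
        have := (Finset.mem_filter.1 hy).2
        exact hF y (fun h => this (Or.inl h)) (fun h => this (Or.inr h))
    rw [h4, Finset.sum_pair hcd]
  rw [h3]
  · simp [h1, h2]
  · intro y h4 h5
    simp [h4, h5]

/-- If `x` does not escape, the exchange sums add up to at most `-2 r`. -/
lemma sum_exchangeSum_le (hdeg : ∀ v, G.degree v = 3)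
    (hA : ∀ ⦃u v⦄, G.Adj u v → (u ∈ A ↔ v ∉ A)) (hx : x ∉ A)
    (hJ : J ⊆ G.neighborFinset x) (hJ2 : J.card = 2)
    (hp0 : 0 ≤ p) (hp1 : p ≤ 1) (hv0 : 0 ≤ v) (hκ0 : 0 ≤ κ) (hκ1 : κ ≤ 1)
    (hr1 : 1 ≤ r) (hr : r ≤ 4 * p * (1 + v * (1 - p))) (hrv : r * v ≤ 4 * κ * p ^ 2)
    (hxW : x ∉ W) (hW : (ballFinset G x (k + 2)).erase x ⊆ W)
    (hfail : ¬ Escapes G A x J k (plusConfig x T)) :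
    ∑ y ∈ W, ((if y ∈ T then 1 else 0) - p) * exchangeSum G A x J p v κ k T y ≤ -2 * r := by
  set ω := plusConfig x T with hω
  have hωx : ω x = true := by simp [hω, plusConfig]
  set D := (ballFinset G x (k + 1) ×ˢ ballFinset G x (k + 1)).filter
      (fun q => G.Adj q.1 q.2) with hD
  set Y := D.filter (fun q => Out G A x J ω q.1 q.2) with hY
  have hfail' := not_escapes_iff.1 hfail
  have hYmem : ∀ q : V × V, Out G A x J ω q.1 q.2 → q ∈ Y := by
    intro q h
    have := h.mem_ballFinset hfail'
    rw [hY, hD]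
    simp only [Finset.mem_filter, Finset.mem_product]
    exact ⟨⟨⟨ballFinset_mono (Nat.le_succ k) this.1, this.2⟩, h.2.1⟩, h⟩
  have htel := sum_out_grandchildren_add_two_le hA hx hJ hJ2 hv0 hfail hωx hD hY
  set new : V × V → ℝ := fun q =>
    ∑ e ∈ Y, if maj G ω q.2 = true ∧ G.Adj q.2 e.1 ∧ e.1 ≠ q.1 ∧ e.2 ≠ q.2 then
      (if ω e.1 then 1 else v) else 0 with hnew
  have hnew0 : 0 ≤ ∑ q ∈ Y, new q := by
    refine Finset.sum_nonneg fun q _ => Finset.sum_nonneg fun e _ => ?_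
    split_ifs <;> linarith
  have hdart : ∀ q ∈ D, ∑ y ∈ W, ((if y ∈ T then 1 else 0) - p) *
      (if y ∈ (G.neighborFinset q.2).erase q.1 then
      ∑ d ∈ ((G.neighborFinset q.2).erase q.1).erase y,
        exchangeTerm G A x J p v κ T q.1 q.2 y d else 0) ≤
      if Out G A x J ω q.1 q.2 then new q - r * (if ω q.1 then 1 else v) else 0 := by
    rintro ⟨b, a⟩ hq
    simp only [hD, Finset.mem_filter, Finset.mem_product] at hq
    obtain ⟨⟨hb, ha⟩, hba⟩ := hq
    obtain ⟨c, d, hbc, hbd, hcd, hN⟩ := exists_neighborFinset_eq hdeg hba.symm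
    have hmemW : ∀ c, c ∈ G.neighborFinset a → c ≠ x → c ∈ W := fun c hc hcx =>
      hW (Finset.mem_erase.2 ⟨hcx, mem_ballFinset_succ ha ((G.mem_neighborFinset a c).1 hc)⟩)
    rw [sum_exchangeTerm_eq hbc hbd hcd hN hxW (hmemW c (by simp [hN])) (hmemW d (by simp [hN]))]
    by_cases hO : Out G A x J ω b a
    · rw [if_pos hO]
      refine (exchangeTerm_add_le hA hx hp0 hp1 hκ0 hκ1 hfail hO hbc hbd hcd hN).trans ?_
      refine sub_le_sub (le_sum_out_grandchildren hdeg hA hv0 hYmem hO hbc hbd hcd hN) ?_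
      rw [← hω]
      by_cases hb : ω b = true
      · simpa [hb] using hr
      · simpa [hb] using hrv
    · rw [if_neg hO, exchangeTerm_eq_zero hO, exchangeTerm_eq_zero hO]
      simp
  calc ∑ y ∈ W, ((if y ∈ T then 1 else 0) - p) * exchangeSum G A x J p v κ k T y
      = ∑ q ∈ D, ∑ y ∈ W, ((if y ∈ T then 1 else 0) - p) *
        (if y ∈ (G.neighborFinset q.2).erase q.1 then
        ∑ d ∈ ((G.neighborFinset q.2).erase q.1).erase y,
          exchangeTerm G A x J p v κ T q.1 q.2 y d else 0) := by
        simp only [exchangeSum, Finset.mul_sum]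
        exact Finset.sum_comm
    _ ≤ ∑ q ∈ D, if Out G A x J ω q.1 q.2 then new q - r * (if ω q.1 then 1 else v) else 0 :=
        Finset.sum_le_sum hdart
    _ = ∑ q ∈ Y, new q - r * ∑ q ∈ Y, (if ω q.1 then 1 else v) := by
        rw [← Finset.sum_filter, ← hY, Finset.sum_sub_distrib, Finset.mul_sum]
    _ ≤ -2 * r := by
        have := mul_le_mul_of_nonneg_left htel (by linarith : 0 ≤ r)
        nlinarith

/-- The two darts that share the closed child `y` through the site `a` have bounded weight. -/
lemma exchangeTerm_add_comm_le (hp0 : 0 ≤ p) (hp1 : p ≤ 1) (hv0 : 0 ≤ v) (hκ0 : 0 ≤ κ)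
    (hfail : ¬ Escapes G A x J k (plusConfig x T)) (hyT : y ∉ T)
    (hbc : y ≠ b) (hbd : y ≠ c) (hcd : b ≠ c) (hN : G.neighborFinset a = {y, b, c}) :
    exchangeTerm G A x J p v κ T b a y c + exchangeTerm G A x J p v κ T c a y b ≤
      2 + 2 * v + 2 * κ * (1 + p) := by
  have hfail' := not_escapes_iff.1 hfail
  unfold exchangeTerm
  rw [Finset.erase_eq_of_notMem hyT]
  have hm := maj_eq_true_iff (ω := plusConfig x T) hbc hbd hcd hN
  have hboth : maj G (plusConfig x T) a = true → Out G A x J (plusConfig x T) b a →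
      Out G A x J (plusConfig x T) c a → False := fun hm h h' =>
    hcd (h.2.2.eq_of_adj hfail' (h.adj hm) h'.2.2 (h'.adj hm))
  have h1 : 0 ≤ v * p := mul_nonneg hv0 hp0
  have h2 : 0 ≤ κ * p := mul_nonneg hκ0 hp0
  have h3 : 0 ≤ κ * (1 - p) := mul_nonneg hκ0 (by linarith)
  unfold exchangeWeight
  cases hb : plusConfig x T b <;> cases hc : plusConfig x T c <;>
    simp only [hb, hc, Bool.false_eq_true, if_true, if_false]
  case true.true =>
    have := hboth (hm.2 (by simp [hb, hc]))
    split_ifs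
    · tauto
    all_goals nlinarith
  all_goals split_ifs <;> nlinarith

lemma exchangeSum_le (hdeg : ∀ v, G.degree v = 3)
    (hp0 : 0 ≤ p) (hp1 : p ≤ 1) (hv0 : 0 ≤ v) (hv1 : v ≤ 1) (hκ0 : 0 ≤ κ)
    (hfail : ¬ Escapes G A x J k (plusConfig x T)) (hyT : y ∉ T) :
    exchangeSum G A x J p v κ k T y ≤ 3 * (2 + 2 * v + 2 * κ * (1 + p)) := by
  unfold exchangeSum
  rw [← Finset.sum_filter, ← Finset.sum_fiberwise_of_maps_to (t := G.neighborFinset y)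
    (g := fun q : V × V => q.2)]
  · refine (Finset.sum_le_card_nsmul _ _ (2 + 2 * v + 2 * κ * (1 + p)) fun a ha => ?_).trans
      (le_of_eq ?_)
    · obtain ⟨b, c, hbc, hbd, hcd, hN⟩ :=
        exists_neighborFinset_eq hdeg ((G.mem_neighborFinset y a).1 ha).symm
      refine le_trans ?_
        (exchangeTerm_add_comm_le hp0 hp1 hv0 hκ0 hfail hyT hbc hbd hcd hN)
      have hb : ((G.neighborFinset a).erase b).erase y = {c} := by
        rw [hN]; ext z; simp only [Finset.mem_erase, Finset.mem_insert, Finset.mem_singleton]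
        constructor
        · tauto
        · rintro rfl
          exact ⟨hbd.symm, hcd.symm, Or.inr (Or.inr rfl)⟩
      have hc : ((G.neighborFinset a).erase c).erase y = {b} := by
        rw [hN]; ext z; simp only [Finset.mem_erase, Finset.mem_insert, Finset.mem_singleton]
        constructor
        · tauto
        · rintro rfl
          exact ⟨hbc.symm, hcd, Or.inr (Or.inl rfl)⟩
      calc _ ≤ ∑ q ∈ ({(b, a), (c, a)} : Finset (V × V)),
            ∑ d ∈ ((G.neighborFinset q.2).erase q.1).erase y,
              exchangeTerm G A x J p v κ T q.1 q.2 y d := by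
            refine Finset.sum_le_sum_of_subset_of_nonneg ?_ fun q _ _ =>
              Finset.sum_nonneg fun d _ => exchangeTerm_nonneg hp0 hp1 hv0 hκ0 hv1
            rintro ⟨b', a'⟩ hq
            simp only [Finset.mem_filter, Finset.mem_erase] at hq
            obtain ⟨⟨⟨-, hadj⟩, hy, -⟩, rfl⟩ := hq
            have := (G.mem_neighborFinset _ _).2 hadj.symm
            rw [hN] at this
            simp only [Finset.mem_insert, Finset.mem_singleton] at this
            simp only [Finset.mem_insert, Finset.mem_singleton, Prod.mk.injEq, and_true]
            rcases this with rfl | h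
            · exact absurd rfl hy
            · exact h
        _ = _ := by
            rw [Finset.sum_pair (by simp [hcd])]
            simp [hb, hc]
    · rw [G.card_neighborFinset_eq_degree, hdeg, nsmul_eq_mul, Nat.cast_ofNat]
  · rintro ⟨b, a⟩ hq
    simp only [Finset.mem_filter, Finset.mem_erase] at hq
    exact (G.mem_neighborFinset _ _).2 (((G.mem_neighborFinset _ _).1 hq.2.2).symm)

lemma exchangeSum_insert (hyT : y ∉ T) :
    exchangeSum G A x J p v κ k (insert y T) y = exchangeSum G A x J p v κ k T y := by
  unfold exchangeSum
  refine Finset.sum_congr rfl fun q _ => ?_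
  split_ifs with hy
  · refine Finset.sum_congr rfl fun d hd => ?_
    have h1 : ∀ u, u ≠ y → plusConfig x (insert y T) u = plusConfig x T u := by
      intro u hu
      simp [plusConfig, hu]
    unfold exchangeTerm
    rw [Finset.erase_insert hyT, Finset.erase_eq_of_notMem hyT,
      h1 q.1 (Finset.mem_erase.1 hy).1.symm, h1 d (Finset.mem_erase.1 hd).1]
  · rfl

/-- The differential inequality for the escape probability. -/
lemma exists_hasDerivAt_escape (hdeg : ∀ v, G.degree v = 3)
    (hA : ∀ ⦃u v⦄, G.Adj u v → (u ∈ A ↔ v ∉ A)) (hx : x ∉ A)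
    (hJ : J ⊆ G.neighborFinset x) (hJ2 : J.card = 2)
    (hp0 : 0 ≤ p) (hp1 : p ≤ 1) (hv0 : 0 ≤ v) (hv1 : v ≤ 1) (hκ0 : 0 ≤ κ) (hκ1 : κ ≤ 1)
    (hr1 : 1 ≤ r) (hr : r ≤ 4 * p * (1 + v * (1 - p))) (hrv : r * v ≤ 4 * κ * p ^ 2)
    (hxW : x ∉ W) (hW : (ballFinset G x (k + 2)).erase x ⊆ W) :
    ∃ D, HasDerivAt (fun q => bernoulliSum q W
        (fun T => if Escapes G A x J k (plusConfig x T) then 1 else 0)) D p ∧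
      2 * r * (1 - bernoulliSum p W
        (fun T => if Escapes G A x J k (plusConfig x T) then 1 else 0)) ≤
      3 * (2 + 2 * v + 2 * κ * (1 + p)) * (p * (1 - p)) * D := by
  obtain ⟨D, hD, he⟩ := exists_hasDerivAt_bernoulliSum p W
    (fun T => if Escapes G A x J k (plusConfig x T) then 1 else 0)
  refine ⟨D, hD, ?_⟩
  rw [mul_assoc _ (p * (1 - p)) D, he, Finset.mul_sum]
  have h0 : ∀ y ∈ W, bernoulliSum p W (fun T => (if y ∈ T then 1 else 0) - p) = 0 := by
    intro y hy
    have h1 := bernoulliSum_insert (p := p) (φ := fun T => (if y ∈ T then 1 else 0) - p)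
      (Finset.notMem_erase y W)
    rw [Finset.insert_erase hy] at h1
    rw [h1, bernoulliSum_congr (ψ := fun _ => -p), bernoulliSum_const,
      bernoulliSum_congr (ψ := fun _ => 1 - p), bernoulliSum_const]
    · ring
    · intro T _; simp
    · intro T hT
      have : y ∉ T := fun h => Finset.notMem_erase y W (hT h)
      simp [this]
  have h1 : ∀ y ∈ W, bernoulliSum p W (fun T => ((if y ∈ T then 1 else 0) - p) *
        if Escapes G A x J k (plusConfig x T) then 1 else 0) =
      bernoulliSum p W (fun T => if ¬ Escapes G A x J k (plusConfig x T) then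
        p - (if y ∈ T then 1 else 0) else 0) := by
    intro y hy
    refine (sub_eq_self.2 (h0 y hy)).symm.trans ?_
    rw [← bernoulliSum_sub]
    refine bernoulliSum_congr fun T _ => ?_
    by_cases h : Escapes G A x J k (plusConfig x T) <;> simp [h]
  have h2 : ∀ y ∈ W, bernoulliSum p W (fun T => if ¬ Escapes G A x J k (plusConfig x T) then
        (p - (if y ∈ T then 1 else 0)) * exchangeSum G A x J p v κ k T y else 0) ≤
      3 * (2 + 2 * v + 2 * κ * (1 + p)) * bernoulliSum p W (fun T => ((if y ∈ T then 1 else 0) - p) *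
        if Escapes G A x J k (plusConfig x T) then 1 else 0) := by
    intro y hy
    rw [h1 y hy]
    exact bernoulliSum_le_of_le hp0 hp1 hy
      (fun T h h' => h (h'.mono (plusConfig_mono (Finset.subset_insert y T))))
      (fun T hT => exchangeSum_insert hT)
      (fun T h hT => exchangeSum_le hdeg hp0 hp1 hv0 hv1 hκ0 h hT)
  refine le_trans ?_ (Finset.sum_le_sum h2)
  rw [← bernoulliSum_sum]
  have h3 : 1 - bernoulliSum p W (fun T => if Escapes G A x J k (plusConfig x T) then 1 else 0) =
      bernoulliSum p W (fun T => if ¬ Escapes G A x J k (plusConfig x T) then 1 else 0) := by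
    refine (congrArg (· - _) (bernoulliSum_const (p := p) (W := W) 1)).symm.trans ?_
    rw [← bernoulliSum_sub]
    refine bernoulliSum_congr fun T _ => ?_
    by_cases h : Escapes G A x J k (plusConfig x T) <;> simp [h]
  rw [h3, ← bernoulliSum_mul_left]
  refine bernoulliSum_mono hp0 hp1 fun T _ => ?_
  by_cases h : Escapes G A x J k (plusConfig x T)
  · simp [h]
  · have h4 := sum_exchangeSum_le hdeg hA hx hJ hJ2 hp0 hp1 hv0 hκ0 hκ1 hr1 hr hrv hxW hW h
    simp only [h, not_false_iff, if_true]
    have h5 : ∑ y ∈ W, (p - if y ∈ T then 1 else 0) * exchangeSum G A x J p v κ k T y =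
        -∑ y ∈ W, ((if y ∈ T then 1 else 0) - p) * exchangeSum G A x J p v κ k T y := by
      rw [← Finset.sum_neg_distrib]
      exact Finset.sum_congr rfl fun y _ => by ring
    rw [h5]
    linarith

end Exchange

section EscapeProbability

open Classical

variable {G : SimpleGraph V} [G.LocallyFinite] {A : Set V} {x : V} {J : Finset V} {k : ℕ}
  {p : ℝ} {W : Finset V}

/-- The probability of the escape event when `x` is open. -/
noncomputable def escapeProb (G : SimpleGraph V) [G.LocallyFinite] (A : Set V) (x : V)
    (J : Finset V) (k : ℕ) (W : Finset V) (q : ℝ) : ℝ :=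
  bernoulliSum q W (fun T => if Escapes G A x J k (plusConfig x T) then 1 else 0)

lemma escapeProb_nonneg (hp0 : 0 ≤ p) (hp1 : p ≤ 1) : 0 ≤ escapeProb G A x J k W p := by
  rw [← bernoulliSum_const (p := p) (W := W) 0]
  exact bernoulliSum_mono hp0 hp1 fun T _ => by split_ifs <;> norm_num

lemma escapeProb_le_one (hp0 : 0 ≤ p) (hp1 : p ≤ 1) : escapeProb G A x J k W p ≤ 1 := by
  refine le_trans ?_ (bernoulliSum_const (p := p) (W := W) 1).le
  exact bernoulliSum_mono hp0 hp1 fun T _ => by split_ifs <;> norm_num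

lemma differentiable_escapeProb : Differentiable ℝ (escapeProb G A x J k W) := fun q =>
  let ⟨_, h, _⟩ := exists_hasDerivAt_bernoulliSum q W _
  h.differentiableAt

lemma le_escapeProb_of_quarter_le (hdeg : ∀ v, G.degree v = 3)
    (hA : ∀ ⦃u v⦄, G.Adj u v → (u ∈ A ↔ v ∉ A)) (hx : x ∉ A)
    (hJ : J ⊆ G.neighborFinset x) (hJ2 : J.card = 2)
    (hxW : x ∉ W) (hW : (ballFinset G x (k + 2)).erase x ⊆ W) (hp : 1 / 4 ≤ p) (hp1 : p ≤ 1) :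
    (4 * p - 1) / 3 ≤ escapeProb G A x J k W p := by
  set h := escapeProb G A x J k W with hh
  have hdiff : Differentiable ℝ h := differentiable_escapeProb
  have main : ∀ q ∈ Set.Ico (1 / 4 : ℝ) 1, (4 * q - 1) / 3 ≤ h q := by
    rintro q ⟨hq, hq1⟩
    have hanti : AntitoneOn (fun s => (1 - h s) / (1 - s)) (Set.Icc (1 / 4 : ℝ) q) := by
      have hne : ∀ s ∈ Set.Icc (1 / 4 : ℝ) q, 1 - s ≠ 0 := fun s hs => by linarith [hs.2]
      refine antitoneOn_of_deriv_nonpos (convex_Icc _ _) ?_ ?_ ?_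
      · exact (continuous_const.sub hdiff.continuous).continuousOn.div
          (continuous_const.sub continuous_id).continuousOn hne
      · intro s hs
        rw [interior_Icc] at hs
        exact (((hdiff s).const_sub 1).div (differentiableAt_id.const_sub 1)
          (hne s (Set.Ioo_subset_Icc_self hs))).differentiableWithinAt
      · intro s hs
        rw [interior_Icc] at hs
        have hs1 : 0 < 1 - s := by linarith [hs.2]
        have hs0 : 0 < s := by linarith [hs.1]
        obtain ⟨D, hD, hle⟩ := exists_hasDerivAt_escape (p := s) (v := 0) (κ := 0) (r := 4 * s)
          hdeg hA hx hJ hJ2 hs0.le (by linarith) le_rfl zero_le_one le_rfl zero_le_one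
          (by linarith [hs.1]) (by linarith) (by simp) hxW hW
        change HasDerivAt h D s at hD
        change 2 * (4 * s) * (1 - h s) ≤ _ at hle
        have h1 : h s ≤ 1 := escapeProb_le_one hs0.le (by linarith)
        have h2 : 4 * (1 - h s) ≤ 3 * ((1 - s) * D) := by
          have : s * (4 * (1 - h s)) ≤ s * (3 * ((1 - s) * D)) := by linarith
          exact le_of_mul_le_mul_left this hs0
        refine le_of_eq_of_le ((hD.const_sub 1).div ((hasDerivAt_id s).const_sub 1) hs1.ne').deriv ?_
        refine div_nonpos_of_nonpos_of_nonneg ?_ (sq_nonneg _)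
        simp only [id]
        linarith
    have h3 := hanti (Set.left_mem_Icc.2 hq) (Set.right_mem_Icc.2 hq) hq
    have h4 : 0 ≤ h (1 / 4) := escapeProb_nonneg (by norm_num) (by norm_num)
    have h5 : 0 < 1 - q := by linarith
    rw [div_le_div_iff₀ h5 (by norm_num)] at h3
    nlinarith
  have hclosed : IsClosed {q | (4 * q - 1) / 3 ≤ h q} :=
    isClosed_le (by fun_prop) hdiff.continuous
  have hsub := closure_minimal main hclosed
  rw [closure_Ico (by norm_num)] at hsub
  exact hsub ⟨hp, hp1⟩

lemma sq_le_escapeProb (hdeg : ∀ v, G.degree v = 3)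
    (hA : ∀ ⦃u v⦄, G.Adj u v → (u ∈ A ↔ v ∉ A)) (hx : x ∉ A)
    (hJ : J ⊆ G.neighborFinset x) (hJ2 : J.card = 2)
    (hxW : x ∉ W) (hW : (ballFinset G x (k + 2)).erase x ⊆ W) (hp : 1 / 3 ≤ p) (hp1 : p ≤ 1) :
    p ^ 2 ≤ escapeProb G A x J k W p := by
  have := le_escapeProb_of_quarter_le hdeg hA hx hJ hJ2 hxW hW (by linarith) hp1
  nlinarith

lemma three_mul_pow_six_le_escapeProb (hdeg : ∀ v, G.degree v = 3)
    (hA : ∀ ⦃u v⦄, G.Adj u v → (u ∈ A ↔ v ∉ A)) (hx : x ∉ A)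
    (hJ : J ⊆ G.neighborFinset x) (hJ2 : J.card = 2)
    (hxW : x ∉ W) (hW : (ballFinset G x (k + 2)).erase x ⊆ W) (hp : 1 / 4 ≤ p) (hp1 : p ≤ 1 / 3) :
    3 * p ^ 6 ≤ escapeProb G A x J k W p := by
  set h := escapeProb G A x J k W with hh
  have hdiff : Differentiable ℝ h := differentiable_escapeProb
  have hq : (11 / 50 : ℝ) ≤ p := by linarith
  have hanti : AntitoneOn (fun s => (1 - h s) * (89 / 100 + s / 2)) (Set.Icc (11 / 50 : ℝ) p) := by
    refine antitoneOn_of_deriv_nonpos (convex_Icc _ _) ?_ ?_ ?_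
    · exact ((continuous_const.sub hdiff.continuous).mul (by fun_prop)).continuousOn
    · intro s hs
      exact (((hdiff s).const_sub 1).mul (by fun_prop)).differentiableWithinAt
    · intro s hs
      rw [interior_Icc] at hs
      have hs1 : s < 1 / 3 := by linarith [hs.2]
      have hs0 : 11 / 50 < s := hs.1
      obtain ⟨D, hD, hle⟩ := exists_hasDerivAt_escape (p := s) (v := 3 / 16) (κ := 1) (r := 1)
        hdeg hA hx hJ hJ2 (by linarith) (by linarith) (by norm_num) (by norm_num) zero_le_one le_rfl
        le_rfl (by nlinarith) (by nlinarith) hxW hW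
      change HasDerivAt h D s at hD
      change 2 * 1 * (1 - h s) ≤ _ at hle
      have h1 : h s ≤ 1 := escapeProb_le_one (by linarith) (by linarith)
      have h2 : 0 < s * (1 - s) := mul_pos (by linarith) (by linarith)
      have h3 : s * (1 - s) ≤ 2 / 9 := by nlinarith
      have h4 : 0 < 3 * (2 + 2 * (3 / 16) + 2 * 1 * (1 + s)) * (s * (1 - s)) := by
        have : 0 < 3 * (2 + 2 * (3 / 16) + 2 * 1 * (1 + s)) := by linarith
        exact mul_pos this h2
      have h5 : 0 ≤ D := by
        by_contra! hneg
        have := mul_neg_of_pos_of_neg h4 hneg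
        linarith
      have h6 : 3 * (2 + 2 * (3 / 16) + 2 * 1 * (1 + s)) * (s * (1 - s)) ≤ 4 := by nlinarith
      have h7 : 1 - h s ≤ 2 * D := by nlinarith [mul_le_mul_of_nonneg_right h6 h5]
      refine le_of_eq_of_le
        ((hD.const_sub 1).mul (((hasDerivAt_id s).div_const 2).const_add (89 / 100))).deriv ?_
      simp only [id]
      nlinarith
  have h3 := hanti (Set.left_mem_Icc.2 hq) (Set.right_mem_Icc.2 hq) hq
  have h4 : 0 ≤ h (11 / 50) := escapeProb_nonneg (by norm_num) (by norm_num)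
  have h5 : h p ≤ 1 := escapeProb_le_one (by linarith) (by linarith)
  have h6 : (1 : ℝ) / 100 ≤ h p := by
    simp only at h3
    nlinarith
  have h7 : p ^ 6 ≤ (1 / 3) ^ 6 := pow_le_pow_left₀ (by linarith) hp1 6
  norm_num at h7
  linarith

end EscapeProbability

section Dynamics

variable {G : SimpleGraph V} [G.LocallyFinite] {A B : Set V} {x u v z : V} {σ ω : V → Bool}
  {Z : Set V} {J : Finset V} {ρ : ℕ → V} {n : ℕ}

lemma maj_eq_true_of_two (huv : u ≠ v) (hu : G.Adj z u) (hv : G.Adj z v) (hσu : σ u = true)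
    (hσv : σ v = true) : maj G σ z = true := by
  classical
  simp only [maj, decide_eq_true_eq]
  rw [← Finset.card_pair huv]
  refine Finset.card_le_card fun y hy => ?_
  simp only [Finset.mem_insert, Finset.mem_singleton] at hy
  rcases hy with rfl | rfl <;> simp [*]

/-- A set in which every site has two neighbors and whose sites in `A` see a plus majority is
plus from time `2` on, and its sites in `A` from time `1` on. -/
lemma domanyTraj_eq_true (hpart : ∀ v, v ∈ A ↔ v ∉ B)
    (hA : ∀ ⦃u v⦄, G.Adj u v → (u ∈ A ↔ v ∉ A))
    (hZ : ∀ z ∈ Z, ∃ u ∈ Z, ∃ v ∈ Z, u ≠ v ∧ G.Adj z u ∧ G.Adj z v)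
    (hmaj : ∀ z ∈ Z, z ∈ A → maj G σ z = true) :
    ∀ n, (∀ z ∈ Z, z ∈ A → domanyTraj G A B σ (n + 1) z = true) ∧
      (1 ≤ n → ∀ z ∈ Z, domanyTraj G A B σ (n + 1) z = true)
  | 0 => ⟨fun z hz hzA => by simp [domanyTraj, hzA, hmaj z hz hzA], fun h => absurd h (by omega)⟩
  | n + 1 => by
    obtain ⟨h1, h2⟩ := domanyTraj_eq_true hpart hA hZ hmaj n
    suffices h : ∀ z ∈ Z, domanyTraj G A B σ (n + 2) z = true from
      ⟨fun z hz _ => h z hz, fun _ => h⟩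
    intro z hz
    obtain ⟨u, hu, v, hv, huv, hzu, hzv⟩ := hZ z hz
    have hAu := hA hzu
    have hAv := hA hzv
    have hzB := hpart z
    rw [domanyTraj]
    rcases Nat.mod_two_eq_zero_or_one (n + 1 + 1) with hn | hn
    · rw [if_neg (show ¬ (n + 1 + 1) % 2 = 1 by omega)]
      by_cases hB : z ∈ B
      · refine (if_pos hB).trans ?_
        exact maj_eq_true_of_two huv hzu hzv (h1 u hu (by tauto)) (h1 v hv (by tauto))
      · refine (if_neg hB).trans ?_
        exact h1 z hz (by tauto)
    · rw [if_pos hn]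
      have h3 := h2 (by omega)
      by_cases hzA : z ∈ A
      · refine (if_pos hzA).trans ?_
        exact maj_eq_true_of_two huv hzu hzv (h3 u hu) (h3 v hv)
      · refine (if_neg hzA).trans ?_
        exact h3 z hz

/-- An infinite self-avoiding path all of whose sites outside `A` are plus. -/
structure OpenRay (G : SimpleGraph V) (A : Set V) (ω : V → Bool) (ρ : ℕ → V) : Prop where
  inj : Function.Injective ρ
  adj : ∀ i, G.Adj (ρ i) (ρ (i + 1))
  plus : ∀ i, ρ i ∉ A → ω (ρ i) = true

lemma domanyTrajE_eq_true (hpart : ∀ v, v ∈ A ↔ v ∉ B)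
    (hA : ∀ ⦃u v⦄, G.Adj u v → (u ∈ A ↔ v ∉ A))
    (hZ : ∀ z ∈ Z, ∃ u ∈ Z, ∃ v ∈ Z, u ≠ v ∧ G.Adj z u ∧ G.Adj z v)
    (hmaj : ∀ z ∈ Z, z ∈ A → maj G σ z = true) (hz : z ∈ Z) (hσz : z ∉ A → σ z = true)
    {n : ℕ∞} (hn : 1 ≤ n) : domanyTrajE G A B σ n z = true := by
  have key := domanyTraj_eq_true hpart hA hZ hmaj
  induction n using ENat.recTopCoe with
  | top =>
    have hev : ∀ᶠ m in Filter.atTop, domanyTraj G A B σ m z = true := by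
      filter_upwards [Filter.eventually_ge_atTop 2] with m hm
      obtain ⟨m, rfl⟩ : ∃ l, m = l + 1 := ⟨m - 1, by omega⟩
      exact (key m).2 (by omega) z hz
    have hex : ∃ b : Bool, ∀ᶠ m in Filter.atTop, domanyTraj G A B σ m z = b := ⟨true, hev⟩
    change domanyLimit G A B σ z = true
    rw [domanyLimit, dif_pos hex]
    obtain ⟨m, h1, h2⟩ := (hev.and hex.choose_spec).exists
    exact h2.symm.trans h1
  | coe m =>
    change domanyTraj G A B σ m z = true
    have hm : 1 ≤ m := by exact_mod_cast hn
    obtain ⟨m, rfl⟩ : ∃ l, m = l + 1 := ⟨m - 1, by omega⟩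
    by_cases hzA : z ∈ A
    · exact (key m).1 z hz hzA
    · rcases Nat.eq_zero_or_pos m with rfl | hm'
      · simpa [domanyTraj, hzA] using hσz hzA
      · exact (key m).2 hm' z hz

/-- If arbitrarily long walks of the plus graph leave `x` away from an open ray, then the ray is
plus at all positive times. -/
lemma OpenRay.infOpenPathFromRel (hpart : ∀ v, v ∈ A ↔ v ∉ B)
    (hA : ∀ ⦃u v⦄, G.Adj u v → (u ∈ A ↔ v ∉ A)) (hx : x ∉ A) (hρ : OpenRay G A σ ρ)
    (hρ0 : ρ 0 = x) (hρ1 : ρ 1 ∉ J) (hesc : ∀ k, Escapes G A x J k σ) {n : ℕ∞} (hn : 1 ≤ n) :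
    InfOpenPathFromRel G.Adj (domanyTrajE G A B σ n) x := by
  classical
  obtain ⟨a, haJ, hxa, hlong⟩ : ∃ a ∈ J, (plusGraph G A σ).Adj x a ∧
      ∀ k, LongFrom (plusGraph G A σ) k x a := by
    by_contra! hcon
    have h1 : ∀ a, ∃ k, a ∈ J → (plusGraph G A σ).Adj x a →
        ¬ LongFrom (plusGraph G A σ) k x a := by
      intro a
      by_cases h : a ∈ J ∧ (plusGraph G A σ).Adj x a
      · obtain ⟨k, hk⟩ := hcon a h.1 h.2
        exact ⟨k, fun _ _ => hk⟩
      · exact ⟨0, fun h2 h3 => absurd ⟨h2, h3⟩ h⟩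
    choose K hK using h1
    obtain ⟨a, ha, hxa, hl⟩ := hesc (J.sup K)
    exact hK a ha hxa (hl.of_le (Finset.le_sup ha))
  let _ : (plusGraph G A σ).LocallyFinite := fun v =>
    (((G.neighborFinset v).finite_toSet).subset fun u hu => by
      simpa using plusGraph_le hu).fintype
  obtain ⟨w, hw0, hw1, hw⟩ := exists_nbWalk_of_longFrom hxa hlong
  have hwadj : ∀ i, (plusGraph G A σ).Adj (w i) (w (i + 1)) := fun i =>
    (hw (i + 1)).adj i (Nat.lt_succ_self i)
  have hwnb : ∀ i, w i ≠ w (i + 2) := fun i => (hw (i + 2)).nb i le_rfl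
  refine ⟨ρ, hρ.inj, hρ0, hρ.adj, fun i => ?_⟩
  refine domanyTrajE_eq_true (Z := Set.range ρ ∪ Set.range w) hpart hA ?_ ?_
    (Or.inl ⟨i, rfl⟩) (hρ.plus i) hn
  · rintro z (⟨i, rfl⟩ | ⟨i, rfl⟩)
    · rcases i with _ | i
      · refine ⟨_, Or.inl ⟨1, rfl⟩, _, Or.inr ⟨1, rfl⟩, ?_, hρ.adj 0, ?_⟩
        · rw [hw1]
          rintro rfl
          exact hρ1 haJ
        · rw [hρ0, hw1]
          exact hxa.1
      · exact ⟨_, Or.inl ⟨i, rfl⟩, _, Or.inl ⟨i + 2, rfl⟩, fun h => by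
          have := hρ.inj h
          omega, (hρ.adj i).symm, hρ.adj (i + 1)⟩
    · rcases i with _ | i
      · refine ⟨_, Or.inl ⟨1, rfl⟩, _, Or.inr ⟨1, rfl⟩, ?_, ?_, (hwadj 0).1⟩
        · rw [hw1]
          rintro rfl
          exact hρ1 haJ
        · rw [hw0, ← hρ0]
          exact hρ.adj 0
      · exact ⟨_, Or.inr ⟨i, rfl⟩, _, Or.inr ⟨i + 2, rfl⟩, hwnb i, (hwadj i).1.symm,
          (hwadj (i + 1)).1⟩
  · rintro z (⟨i, rfl⟩ | ⟨i, rfl⟩) hzA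
    · rcases i with _ | i
      · rw [hρ0] at hzA
        exact absurd hzA hx
      · have h1 := hA (hρ.adj i)
        have h2 := hA (hρ.adj (i + 1))
        refine maj_eq_true_of_two (fun h => ?_) (hρ.adj i).symm (hρ.adj (i + 1))
          (hρ.plus i (by tauto)) (hρ.plus (i + 2) (by tauto))
        have := hρ.inj h
        omega
    · exact (hwadj i).2.1 hzA

/-- An infinite open path for the adjacency at distance two yields an open ray. -/
lemma exists_openRay (hpart : ∀ v, v ∈ A ↔ v ∉ B)
    (h : InfOpenPathFromRel (BAdj G A B) ω x) : ∃ ρ, OpenRay G A ω ρ ∧ ρ 0 = x := by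
  obtain ⟨γ, hinj, hγ0, hR, hopen⟩ := h
  choose α hαA hα1 hα2 using fun n => (hR n).2.2.2
  have hB : ∀ n, γ n ∉ A := fun n => by
    have := (hR n).1
    have := hpart (γ n)
    tauto
  have hfin : ∀ i, {j | G.Adj (α i) (γ j)}.Finite := fun i =>
    ((G.neighborFinset (α i)).finite_toSet.preimage hinj.injOn).subset fun j hj => by
      simpa using hj
  have hstep : ∀ i, ∃ j, i < j ∧ G.Adj (α i) (γ j) ∧ ∀ l, G.Adj (α i) (γ l) → l ≤ j := by
    intro i
    obtain ⟨j, hj, hmax⟩ := (hfin i).exists_maximalFor id _ ⟨i + 1, hα2 i⟩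
    have hmax' : ∀ l, G.Adj (α i) (γ l) → l ≤ j := fun l hl =>
      (le_total l j).elim id fun h => hmax hl h
    exact ⟨j, hmax' _ (hα2 i), hj, hmax'⟩
  choose next hlt hadj hmax using hstep
  let t : ℕ → ℕ := fun n => next^[n] 0
  have ht : ∀ n, t (n + 1) = next (t n) := fun n => Function.iterate_succ_apply' next n 0
  have htmono : StrictMono t := strictMono_nat_of_lt_succ fun n => by rw [ht]; exact hlt _
  let ρ : ℕ → V := fun n => if n % 2 = 0 then γ (t (n / 2)) else α (t (n / 2))
  have heven : ∀ m, ρ (2 * m) = γ (t m) := fun m => by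
    simp only [ρ, Nat.mul_mod_right, if_true]
    congr 2
    omega
  have hodd : ∀ m, ρ (2 * m + 1) = α (t m) := fun m => by
    simp only [ρ, show (2 * m + 1) % 2 = 1 by omega, one_ne_zero, if_false]
    congr 2
    omega
  have hαinj : ∀ m n, m < n → α (t m) ≠ α (t n) := by
    intro m n hmn he
    have h1 : G.Adj (α (t m)) (γ (t (n + 1))) := by
      rw [he, ht]
      exact hadj _
    have h2 := hmax _ _ h1
    rw [← ht] at h2
    have := htmono (show m + 1 < n + 1 by omega)
    omega
  refine ⟨ρ, ⟨fun i j hij => ?_, fun i => ?_, fun i hi => ?_⟩, ?_⟩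
  · rcases Nat.even_or_odd' i with ⟨m, rfl | rfl⟩ <;> rcases Nat.even_or_odd' j with ⟨n, rfl | rfl⟩
    · rw [heven, heven] at hij
      rw [htmono.injective (hinj hij)]
    · rw [heven, hodd] at hij
      exact absurd (hij ▸ hαA _) (hB _)
    · rw [heven, hodd] at hij
      exact absurd (hij ▸ hαA _) (hB _)
    · rw [hodd, hodd] at hij
      rcases Nat.lt_trichotomy m n with h | rfl | h
      · exact absurd hij (hαinj _ _ h)
      · rfl
      · exact absurd hij.symm (hαinj _ _ h)
  · rcases Nat.even_or_odd' i with ⟨m, rfl | rfl⟩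
    · rw [heven, hodd]
      exact hα1 _
    · rw [hodd, show 2 * m + 1 + 1 = 2 * (m + 1) by omega, heven, ht]
      exact hadj _
  · rcases Nat.even_or_odd' i with ⟨m, rfl | rfl⟩
    · rw [heven]
      exact hopen _
    · rw [hodd] at hi
      exact absurd (hαA _) hi
  · rw [show (0 : ℕ) = 2 * 0 by rfl, heven]
    exact hγ0

end Dynamics

section IncreasingCylinders

variable {E F : Set (V → Bool)}

/-- The event is increasing and depends on finitely many sites. -/
def IncCylinder (E : Set (V → Bool)) : Prop :=
  ∃ S : Finset V, ∀ ω ∈ E, ∀ ω', (∀ v ∈ S, ω v = true → ω' v = true) → ω' ∈ E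

lemma IncCylinder.inter (hE : IncCylinder E) (hF : IncCylinder F) : IncCylinder (E ∩ F) := by
  classical
  obtain ⟨S, hS⟩ := hE
  obtain ⟨S', hS'⟩ := hF
  exact ⟨S ∪ S', fun ω hω ω' h =>
    ⟨hS ω hω.1 ω' fun v hv => h v (Finset.mem_union_left _ hv),
      hS' ω hω.2 ω' fun v hv => h v (Finset.mem_union_right _ hv)⟩⟩

open Classical in
/-- A cylinder event is the union of the elementary cylinders it contains. -/
lemma eq_biUnion_of_local {S : Finset V}
    (hS : ∀ ω ∈ E, ∀ ω', (∀ v ∈ S, ω v = true → ω' v = true) → ω' ∈ E) :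
    E = ⋃ T ∈ S.powerset.filter (fun T => (fun v => decide (v ∈ T)) ∈ E),
      {ω : V → Bool | ∀ v ∈ S, ω v = decide (v ∈ T)} := by
  ext ω
  simp only [Set.mem_iUnion, Finset.mem_filter, Finset.mem_powerset, Set.mem_ofPred_eq,
    exists_prop]
  constructor
  · intro hω
    refine ⟨S.filter fun v => ω v = true, ⟨Finset.filter_subset _ _, hS ω hω _ fun v hv h => ?_⟩,
      fun v hv => ?_⟩
    · simp [hv, h]
    · simp [hv]
  · rintro ⟨T, ⟨-, hT⟩, h⟩
    exact hS _ hT ω fun v hv hvT => by rw [h v hv, hvT]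

lemma measurableSet_elementary (S : Finset V) (f : V → Bool) :
    MeasurableSet {ω : V → Bool | ∀ v ∈ S, ω v = f v} := by
  have h : {ω : V → Bool | ∀ v ∈ S, ω v = f v} = ⋂ v ∈ S, (fun ω => ω v) ⁻¹' {f v} := by
    ext ω
    simp
  rw [h]
  exact S.measurableSet_biInter fun v _ => measurable_pi_apply v (measurableSet_singleton _)

lemma IncCylinder.measurableSet (hE : IncCylinder E) : MeasurableSet E := by
  obtain ⟨S, hS⟩ := hE
  rw [eq_biUnion_of_local hS]
  exact Finset.measurableSet_biUnion _ fun T _ => measurableSet_elementary S _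

variable {p : ℝ} {P : Measure (V → Bool)}

open Classical in
lemma measure_eq_bernoulliSum (hp0 : 0 ≤ p) (hp1 : p ≤ 1)
    (hP : ∀ (s : Finset V) (f : V → Bool), P {ω | ∀ v ∈ s, ω v = f v} =
      ∏ v ∈ s, (if f v then ENNReal.ofReal p else ENNReal.ofReal (1 - p)))
    {S : Finset V} (hS : ∀ ω ∈ E, ∀ ω', (∀ v ∈ S, ω v = true → ω' v = true) → ω' ∈ E) :
    P E = ENNReal.ofReal
      (bernoulliSum p S fun T => if (fun v => decide (v ∈ T)) ∈ E then 1 else 0) := by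
  have hq : 0 ≤ 1 - p := by linarith
  conv_lhs => rw [eq_biUnion_of_local hS]
  rw [measure_biUnion_finset, bernoulliSum, ENNReal.ofReal_sum_of_nonneg, Finset.sum_filter]
  · refine Finset.sum_congr rfl fun T hT => ?_
    rw [Finset.mem_powerset] at hT
    split_ifs
    · rw [hP, mul_one, ENNReal.ofReal_mul (by positivity), ENNReal.ofReal_pow hp0,
        ENNReal.ofReal_pow hq, ← Finset.prod_sdiff hT, mul_comm]
      congr 1
      · exact Finset.prod_eq_pow_card fun v hv => by simp [hv]
      · exact Finset.prod_eq_pow_card fun v hv => by simp [(Finset.mem_sdiff.1 hv).2]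
    · simp
  · intro T _
    split_ifs <;> positivity
  · intro T hT T' hT' hne
    rw [Function.onFun, Set.disjoint_left]
    intro ω h h'
    simp only [Finset.coe_filter, Finset.mem_powerset, Set.mem_ofPred_eq] at hT hT'
    refine hne (Finset.ext fun v => ⟨fun hv => ?_, fun hv => ?_⟩)
    · have := (h v (hT.1 hv)).symm.trans (h' v (hT.1 hv))
      simpa [hv] using this
    · have := (h v (hT'.1 hv)).symm.trans (h' v (hT'.1 hv))
      simpa [hv] using this
  · exact fun T _ => measurableSet_elementary S _

lemma IncCylinder.mul_le (hp0 : 0 ≤ p) (hp1 : p ≤ 1)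
    (hP : ∀ (s : Finset V) (f : V → Bool), P {ω | ∀ v ∈ s, ω v = f v} =
      ∏ v ∈ s, (if f v then ENNReal.ofReal p else ENNReal.ofReal (1 - p)))
    (hE : IncCylinder E) (hF : IncCylinder F) : P E * P F ≤ P (E ∩ F) := by
  classical
  obtain ⟨S, hS⟩ := hE
  obtain ⟨S', hS'⟩ := hF
  have h1 : ∀ ω ∈ E, ∀ ω', (∀ v ∈ S ∪ S', ω v = true → ω' v = true) → ω' ∈ E :=
    fun ω hω ω' h => hS ω hω ω' fun v hv => h v (Finset.mem_union_left _ hv)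
  have h2 : ∀ ω ∈ F, ∀ ω', (∀ v ∈ S ∪ S', ω v = true → ω' v = true) → ω' ∈ F :=
    fun ω hω ω' h => hS' ω hω ω' fun v hv => h v (Finset.mem_union_right _ hv)
  have h3 : ∀ ω ∈ E ∩ F, ∀ ω', (∀ v ∈ S ∪ S', ω v = true → ω' v = true) → ω' ∈ E ∩ F :=
    fun ω hω ω' h => ⟨h1 ω hω.1 ω' h, h2 ω hω.2 ω' h⟩
  have hmono : ∀ {D : Set (V → Bool)},
      (∀ ω ∈ D, ∀ ω', (∀ v ∈ S ∪ S', ω v = true → ω' v = true) → ω' ∈ D) →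
      Monotone fun T : Finset V => if (fun v => decide (v ∈ T)) ∈ D then (1 : ℝ) else 0 := by
    intro D hD T T' hT
    dsimp only
    split_ifs with h h'
    · exact le_rfl
    · refine absurd (hD _ h _ fun v _ hv => ?_) h'
      simp only [decide_eq_true_eq] at hv ⊢
      exact hT hv
    · exact zero_le_one
    · exact le_rfl
  rw [measure_eq_bernoulliSum hp0 hp1 hP h1, measure_eq_bernoulliSum hp0 hp1 hP h2,
    measure_eq_bernoulliSum hp0 hp1 hP h3, ← ENNReal.ofReal_mul]
  · refine ENNReal.ofReal_le_ofReal
      ((bernoulliSum_mul_le hp0 hp1 (hmono h1) (hmono h2)).trans_eq (bernoulliSum_congr ?_))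
    intro T _
    rw [ite_zero_mul_ite_zero, mul_one]
    split_ifs with h h' h' <;> first | rfl | exact absurd h h' | exact absurd h' h
  · exact (bernoulliSum_const (p := p) (W := S ∪ S') 0).symm.le.trans
      (bernoulliSum_mono hp0 hp1 fun T _ => by split_ifs <;> norm_num)

lemma mul_measure_iInter_le [IsProbabilityMeasure P] (hp0 : 0 ≤ p) (hp1 : p ≤ 1)
    (hP : ∀ (s : Finset V) (f : V → Bool), P {ω | ∀ v ∈ s, ω v = f v} =
      ∏ v ∈ s, (if f v then ENNReal.ofReal p else ENNReal.ofReal (1 - p)))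
    {C D : ℕ → Set (V → Bool)} (hC : Antitone C) (hD : Antitone D)
    (hC' : ∀ k, IncCylinder (C k)) (hD' : ∀ k, IncCylinder (D k)) {h : ENNReal}
    (hh : ∀ k, h ≤ P (C k)) : h * P (⋂ k, D k) ≤ P (⋂ k, C k ∩ D k) := by
  have hanti : Antitone fun k => C k ∩ D k := fun k l hkl => Set.inter_subset_inter (hC hkl) (hD hkl)
  rw [hanti.measure_iInter
    (fun k => ((hC' k).inter (hD' k)).measurableSet.nullMeasurableSet) ⟨0, measure_ne_top _ _⟩]
  refine le_iInf fun k => ?_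
  exact (mul_le_mul' (hh k) (measure_mono (Set.iInter_subset D k))).trans
    ((hC' k).mul_le hp0 hp1 hP (hD' k))

end IncreasingCylinders

section Approximation

variable {G : SimpleGraph V} [G.LocallyFinite] {A B : Set V} {x u v z : V} {ω ω' : V → Bool}
  {J : Finset V} {ρ ρ' : ℕ → V} {k m n : ℕ}

lemma maj_mono_of_neighbors (hω : ∀ v, G.Adj u v → ω v = true → ω' v = true)
    (h : maj G ω u = true) : maj G ω' u = true := by
  classical
  rw [← maj_congr (ω := fun v => if G.Adj u v then ω' v else true) fun v hv => if_pos hv]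
  refine maj_mono (fun v hv => ?_) h
  split_ifs with huv
  · exact hω v huv hv
  · rfl

lemma plusGraph_adj_of_ball (hu : u ∈ ballFinset G x m)
    (hω : ∀ v ∈ ballFinset G x (m + 2), ω v = true → ω' v = true)
    (h : (plusGraph G A ω).Adj u v) : (plusGraph G A ω').Adj u v := by
  have hv := mem_ballFinset_succ hu h.1
  exact ⟨h.1, fun huA => maj_mono_of_neighbors (fun z hz => hω z
      (ballFinset_mono (Nat.le_succ _) (mem_ballFinset_succ hu hz))) (h.2.1 huA),
    fun hvA => maj_mono_of_neighbors (fun z hz => hω z (mem_ballFinset_succ hv hz)) (h.2.2 hvA)⟩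

lemma LongFrom.of_ball : ∀ {k m : ℕ} {u v : V}, v ∈ ballFinset G x m →
    (∀ v ∈ ballFinset G x (m + k + 1), ω v = true → ω' v = true) →
    LongFrom (plusGraph G A ω) k u v → LongFrom (plusGraph G A ω') k u v
  | 0, _, _, _, _, _, _ => trivial
  | k + 1, m, _, _, hv, hω, ⟨z, hz, hne, h⟩ =>
    ⟨z, plusGraph_adj_of_ball hv (fun y hy => hω y (ballFinset_mono (by omega) hy)) hz, hne,
      h.of_ball (m := m + 1) (mem_ballFinset_succ hv hz.1)
        fun y hy => hω y (ballFinset_mono (by omega) hy)⟩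

lemma Escapes.of_ball (hω : ∀ v ∈ ballFinset G x (k + 2), ω v = true → ω' v = true)
    (h : Escapes G A x J k ω) : Escapes G A x J k ω' := by
  obtain ⟨a, ha, hxa, hl⟩ := h
  have hx : x ∈ ballFinset G x 0 := Finset.mem_singleton_self x
  exact ⟨a, ha, plusGraph_adj_of_ball hx (fun y hy => hω y (ballFinset_mono (by omega) hy)) hxa,
    hl.of_ball (mem_ballFinset_succ hx hxa.1)
      fun y hy => hω y (ballFinset_mono (by omega) hy)⟩

open Classical in
/-- The event that long walks of the plus graph leave `x` through `J` once `x` is made plus. -/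
def escapeEvent (G : SimpleGraph V) [G.LocallyFinite] (A : Set V) (x : V) (J : Finset V) (k : ℕ) :
    Set (V → Bool) :=
  {ω | Escapes G A x J k (Function.update ω x true)}

lemma escapeEvent_antitone : Antitone (escapeEvent G A x J) := by
  rintro k l hkl ω ⟨a, ha, hxa, h⟩
  exact ⟨a, ha, hxa, h.of_le hkl⟩

lemma incCylinder_escapeEvent (k : ℕ) : IncCylinder (escapeEvent G A x J k) := by
  classical
  refine ⟨ballFinset G x (k + 2), fun ω hω ω' h => Escapes.of_ball (fun v hv h1 => ?_) hω⟩
  by_cases hvx : v = x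
  · simp [hvx]
  · rw [Function.update_of_ne hvx] at h1 ⊢
    exact h v hv h1

lemma ofReal_escapeProb_le {p : ℝ} {P : Measure (V → Bool)} (hp0 : 0 ≤ p) (hp1 : p ≤ 1)
    (hP : ∀ (s : Finset V) (f : V → Bool), P {ω | ∀ v ∈ s, ω v = f v} =
      ∏ v ∈ s, (if f v then ENNReal.ofReal p else ENNReal.ofReal (1 - p)))
    {W : Finset V} (hxW : x ∉ W) :
    ENNReal.ofReal (escapeProb G A x J k W p) ≤ P (escapeEvent G A x J k) := by
  classical
  let E : Set (V → Bool) := {ω | Escapes G A x J k (plusConfig x (W.filter fun v => ω v = true))}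
  have hE : ∀ ω ∈ E, ∀ ω', (∀ v ∈ W, ω v = true → ω' v = true) → ω' ∈ E := by
    intro ω hω ω' h
    refine Escapes.mono (fun v hv => plusConfig_mono (fun y hy => ?_) v hv) hω
    rw [Finset.mem_filter] at hy ⊢
    exact ⟨hy.1, h y hy.1 hy.2⟩
  have hE' : E ⊆ escapeEvent G A x J k := by
    intro ω hω
    refine Escapes.mono (fun v hv => ?_) hω
    simp only [plusConfig, Finset.mem_filter, decide_eq_true_eq] at hv
    rcases hv with rfl | hv
    · simp
    · rw [Function.update_of_ne (ne_of_mem_of_not_mem hv.1 hxW)]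
      exact hv.2
  refine le_trans (le_of_eq ?_) (measure_mono hE')
  rw [measure_eq_bernoulliSum hp0 hp1 hP hE, escapeProb]
  congr 1
  refine bernoulliSum_congr fun T hT => if_congr ?_ rfl rfl
  change _ ↔ Escapes G A x J k _
  have : (W.filter fun v => decide (v ∈ T) = true) = T := by
    ext v
    simp only [Finset.mem_filter, decide_eq_true_eq]
    exact ⟨fun h => h.2, fun h => ⟨hT h, h⟩⟩
  rw [this]

/-- The first `n` steps of `ρ` form a self-avoiding path of `G`. -/
structure SelfAvoiding (G : SimpleGraph V) (ρ : ℕ → V) (n : ℕ) : Prop where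
  adj : ∀ i < n, G.Adj (ρ i) (ρ (i + 1))
  inj : ∀ i ≤ n, ∀ j ≤ n, ρ i = ρ j → i = j

/-- Some self-avoiding path with `k + 1` steps starts at `x` into `J` and is plus outside `A`. -/
def rayEvent (G : SimpleGraph V) (A : Set V) (x : V) (J : Finset V) (k : ℕ) : Set (V → Bool) :=
  {ω | ∃ ρ, SelfAvoiding G ρ (k + 1) ∧ ρ 0 = x ∧ ρ 1 ∈ J ∧
    ∀ i ≤ k + 1, ρ i ∉ A → ω (ρ i) = true}

lemma SelfAvoiding.mem_ballFinset (h : SelfAvoiding G ρ n) (h0 : ρ 0 = x) :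
    ∀ i ≤ n, ρ i ∈ ballFinset G x i
  | 0, _ => by rw [h0]; exact Finset.mem_singleton_self x
  | i + 1, hi => mem_ballFinset_succ (h.mem_ballFinset h0 i (by omega)) (h.adj i hi)

omit [G.LocallyFinite] in
lemma rayEvent_antitone : Antitone (rayEvent G A x J) := by
  rintro k l hkl ω ⟨ρ, h, h0, h1, hω⟩
  exact ⟨ρ, ⟨fun i hi => h.adj i (by omega), fun i hi j hj => h.inj i (by omega) j (by omega)⟩,
    h0, h1, fun i hi => hω i (by omega)⟩

lemma incCylinder_rayEvent (k : ℕ) : IncCylinder (rayEvent G A x J k) := by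
  refine ⟨ballFinset G x (k + 1), ?_⟩
  rintro ω ⟨ρ, h, h0, h1, hω⟩ ω' h'
  exact ⟨ρ, h, h0, h1, fun i hi hiA =>
    h' _ (ballFinset_mono hi (h.mem_ballFinset h0 i hi)) (hω i hi hiA)⟩

omit [G.LocallyFinite] in
lemma OpenRay.mem_rayEvent (h : OpenRay G A ω ρ) (h0 : ρ 0 = x) (h1 : ρ 1 ∈ J) (k : ℕ) :
    ω ∈ rayEvent G A x J k :=
  ⟨ρ, ⟨fun i _ => h.adj i, fun _ _ _ _ hij => h.inj hij⟩, h0, h1, fun i _ => h.plus i⟩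

/-- Long open paths from `x` have an open ray as a subsequential limit. -/
lemma exists_openRay_of_rayEvent (h : ∀ k, ω ∈ rayEvent G A x J k) :
    ∃ ρ, OpenRay G A ω ρ ∧ ρ 0 = x ∧ ρ 1 ∈ J := by
  choose r hr hr0 hr1 hω using h
  let U : Ultrafilter ℕ := Filter.hyperfilter ℕ
  have hU : ∀ n, ∀ᶠ k in (U : Filter ℕ), n ≤ k := fun n =>
    Nat.hyperfilter_le_atTop (Filter.eventually_ge_atTop n)
  have hlim : ∀ i, ∃ v, ∀ᶠ k in (U : Filter ℕ), r k i = v := by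
    intro i
    have h1 : ∀ᶠ k in (U : Filter ℕ), ∃ v ∈ (ballFinset G x i : Set V), r k i = v := by
      filter_upwards [hU i] with k hk
      exact ⟨_, (hr k).mem_ballFinset (hr0 k) i (by omega), rfl⟩
    obtain ⟨v, -, hv⟩ := (Ultrafilter.eventually_exists_mem_iff (Finset.finite_toSet _)).1 h1
    exact ⟨v, hv⟩
  choose ρ hρ using hlim
  refine ⟨ρ, ⟨fun i j hij => ?_, fun i => ?_, fun i hi => ?_⟩, ?_, ?_⟩
  · obtain ⟨k, h1, h2, h3⟩ := ((hρ i).and ((hρ j).and (hU (i + j)))).exists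
    exact (hr k).inj i (by omega) j (by omega) (h1.trans (hij.trans h2.symm))
  · obtain ⟨k, h1, h2, h3⟩ := ((hρ i).and ((hρ (i + 1)).and (hU i))).exists
    rw [← h1, ← h2]
    exact (hr k).adj i (by omega)
  · obtain ⟨k, h1, h3⟩ := ((hρ i).and (hU i)).exists
    rw [← h1] at hi ⊢
    exact hω k i (by omega) hi
  · obtain ⟨k, h1⟩ := (hρ 0).exists
    rw [← h1, hr0]
  · obtain ⟨k, h1⟩ := (hρ 1).exists
    rw [← h1]
    exact hr1 k

open Classical in
/-- There are at most `3 * 2 ^ k` self-avoiding paths with `k + 1` steps from `x`. -/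
lemma exists_finset_selfAvoiding (hdeg : ∀ v, G.degree v = 3) (x : V) :
    ∀ k, ∃ L : Finset (ℕ → V), L.card ≤ 3 * 2 ^ k ∧
      ∀ ρ, SelfAvoiding G ρ (k + 1) → ρ 0 = x → ∃ f ∈ L, ∀ i ≤ k + 1, ρ i = f i
  | 0 => by
    refine ⟨(G.neighborFinset x).image fun v i => if i = 0 then x else v,
      Finset.card_image_le.trans (hdeg x).le, fun ρ h h0 => ⟨_, Finset.mem_image_of_mem _
        (show ρ 1 ∈ _ by simpa [h0] using h.adj 0 (by omega)), fun i hi => ?_⟩⟩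
    obtain rfl | rfl : i = 0 ∨ i = 1 := by omega
    · simp [h0]
    · simp
  | k + 1 => by
    obtain ⟨L, hL, hcov⟩ := exists_finset_selfAvoiding hdeg x k
    refine ⟨(L.filter fun f => G.Adj (f (k + 1)) (f k)).biUnion fun f =>
      ((G.neighborFinset (f (k + 1))).erase (f k)).image fun v => Function.update f (k + 2) v,
      ?_, fun ρ h h0 => ?_⟩
    · refine (Finset.card_biUnion_le_card_mul _ _ 2 fun f hf => ?_).trans ?_
      · refine Finset.card_image_le.trans ?_
        rw [Finset.card_erase_of_mem (by simpa using (Finset.mem_filter.1 hf).2)]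
        have := hdeg (f (k + 1))
        rw [SimpleGraph.degree] at this
        omega
      · have := Finset.card_filter_le L fun f => G.Adj (f (k + 1)) (f k)
        rw [pow_succ]
        omega
    · obtain ⟨f, hf, hρf⟩ := hcov ρ ⟨fun i hi => h.adj i (by omega),
        fun i hi j hj => h.inj i (by omega) j (by omega)⟩ h0
      refine ⟨Function.update f (k + 2) (ρ (k + 2)), ?_, fun i hi => ?_⟩
      · refine Finset.mem_biUnion.2 ⟨f, Finset.mem_filter.2 ⟨hf, ?_⟩,
          Finset.mem_image_of_mem _ (Finset.mem_erase.2 ⟨?_, ?_⟩)⟩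
        · rw [← hρf (k + 1) le_rfl, ← hρf k (by omega)]
          exact (h.adj k (by omega)).symm
        · rw [← hρf k (by omega)]
          intro he
          have := h.inj (k + 2) le_rfl k (by omega) he
          omega
        · rw [SimpleGraph.mem_neighborFinset, ← hρf (k + 1) le_rfl]
          exact h.adj (k + 1) (by omega)
      · by_cases hik : i = k + 2
        · simp [hik]
        · rw [Function.update_of_ne hik]
          exact hρf i (by omega)

omit [G.LocallyFinite] in
lemma SelfAvoiding.notMem_of_even (hA : ∀ ⦃u v⦄, G.Adj u v → (u ∈ A ↔ v ∉ A))
    (h : SelfAvoiding G ρ n) (h0 : ρ 0 ∉ A) : ∀ i, 2 * i ≤ n → ρ (2 * i) ∉ A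
  | 0, _ => h0
  | i + 1, hi => by
    have h1 := h.notMem_of_even hA h0 i (by omega)
    have h2 := hA (h.adj (2 * i) (by omega))
    have h3 := hA (h.adj (2 * i + 1) (by omega))
    rw [show 2 * (i + 1) = 2 * i + 1 + 1 by omega]
    tauto

lemma measure_rayEvent_le {p : ℝ} {P : Measure (V → Bool)} (hdeg : ∀ v, G.degree v = 3)
    (hA : ∀ ⦃u v⦄, G.Adj u v → (u ∈ A ↔ v ∉ A)) (hx : x ∉ A) (hp0 : 0 ≤ p)
    (hP : ∀ (s : Finset V) (f : V → Bool), P {ω | ∀ v ∈ s, ω v = f v} =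
      ∏ v ∈ s, (if f v then ENNReal.ofReal p else ENNReal.ofReal (1 - p))) (j : ℕ) :
    P (rayEvent G A x J (2 * j + 1)) ≤ ENNReal.ofReal (6 * p ^ 2 * (4 * p) ^ j) := by
  classical
  obtain ⟨L, hL, hcov⟩ := exists_finset_selfAvoiding hdeg x (2 * j + 1)
  set L' := L.filter fun f => SelfAvoiding G f (2 * j + 2) ∧ f 0 = x with hL'
  let s : (ℕ → V) → Finset V := fun f => (Finset.range (j + 2)).image fun i => f (2 * i)
  have hsub : rayEvent G A x J (2 * j + 1) ⊆
      ⋃ f ∈ L', {ω : V → Bool | ∀ v ∈ s f, ω v = (fun _ => true) v} := by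
    rintro ω ⟨ρ, h, h0, -, hω⟩
    obtain ⟨f, hf, hρf⟩ := hcov ρ h h0
    have hfS : SelfAvoiding G f (2 * j + 2) :=
      ⟨fun i hi => by
        rw [← hρf i (by omega), ← hρf (i + 1) (by omega)]
        exact h.adj i hi, fun i hi k hk hik => h.inj i hi k hk (by rw [hρf i hi, hρf k hk, hik])⟩
    refine Set.mem_biUnion (Finset.mem_filter.2 ⟨hf, hfS, by rw [← hρf 0 (by omega), h0]⟩)
      fun v hv => ?_
    obtain ⟨i, hi, rfl⟩ := Finset.mem_image.1 hv
    rw [Finset.mem_range] at hi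
    dsimp only
    rw [← hρf (2 * i) (by omega)]
    exact hω _ (by omega) (h.notMem_of_even hA (h0 ▸ hx) i (by omega))
  refine (measure_mono hsub).trans ((measure_biUnion_finset_le _ _).trans ?_)
  have hterm : ∀ f ∈ L', P {ω : V → Bool | ∀ v ∈ s f, ω v = (fun _ => true) v} ≤
      ENNReal.ofReal (p ^ (j + 2)) := by
    intro f hf
    have hfS := (Finset.mem_filter.1 hf).2.1
    have hcard : (s f).card = j + 2 := by
      rw [Finset.card_image_of_injOn, Finset.card_range]
      intro i hi i' hi' he
      simp only [Finset.coe_range, Set.mem_Iio] at hi hi'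
      have := hfS.inj (2 * i) (by omega) (2 * i') (by omega) he
      omega
    rw [hP, ENNReal.ofReal_pow hp0, ← hcard, ← Finset.prod_const]
    simp
  refine (Finset.sum_le_card_nsmul _ _ _ hterm).trans ?_
  have hcard : L'.card ≤ 3 * 2 ^ (2 * j + 1) := (Finset.card_filter_le _ _).trans hL
  rw [nsmul_eq_mul, ← ENNReal.ofReal_natCast, ← ENNReal.ofReal_mul (by positivity)]
  refine ENNReal.ofReal_le_ofReal ?_
  calc (L'.card : ℝ) * p ^ (j + 2) ≤ (3 * 2 ^ (2 * j + 1) : ℕ) * p ^ (j + 2) := by gcongr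
    _ = 6 * p ^ 2 * (4 * p) ^ j := by
      push_cast
      rw [pow_succ, pow_mul, mul_pow]
      ring

lemma measure_iInter_rayEvent_eq_zero {p : ℝ} {P : Measure (V → Bool)}
    (hdeg : ∀ v, G.degree v = 3) (hA : ∀ ⦃u v⦄, G.Adj u v → (u ∈ A ↔ v ∉ A)) (hx : x ∉ A)
    (hp0 : 0 ≤ p) (hp : p < 1 / 4)
    (hP : ∀ (s : Finset V) (f : V → Bool), P {ω | ∀ v ∈ s, ω v = f v} =
      ∏ v ∈ s, (if f v then ENNReal.ofReal p else ENNReal.ofReal (1 - p))) :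
    P (⋂ k, rayEvent G A x J k) = 0 := by
  have hlim : Filter.Tendsto (fun j : ℕ => ENNReal.ofReal (6 * p ^ 2 * (4 * p) ^ j)) Filter.atTop
      (nhds 0) := by
    rw [← ENNReal.ofReal_zero]
    refine ENNReal.tendsto_ofReal ?_
    simpa using (tendsto_pow_atTop_nhds_zero_of_lt_one (by linarith)
      (show 4 * p < 1 by linarith)).const_mul (6 * p ^ 2)
  refine le_antisymm (ge_of_tendsto' hlim fun j => ?_) zero_le
  exact (measure_mono (Set.iInter_subset _ (2 * j + 1))).trans
    (measure_rayEvent_le hdeg hA hx hp0 hP j)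

end Approximation

section LowerBound

variable {G : SimpleGraph V} [G.LocallyFinite] {A B : Set V} {x : V} {ω : V → Bool}
  {J : Finset V} {p : ℝ} {P : Measure (V → Bool)}

open Classical in
lemma infOpenPathFromRel_of_rayEvent (hpart : ∀ v, v ∈ A ↔ v ∉ B)
    (hA : ∀ ⦃u v⦄, G.Adj u v → (u ∈ A ↔ v ∉ A)) (hx : x ∉ A)
    (hray : ∀ k, ω ∈ rayEvent G A x J k)
    (hesc : ∀ a ∈ J, ∀ k, ω ∈ escapeEvent G A x ((G.neighborFinset x).erase a) k)
    {n : ℕ∞} (hn : 1 ≤ n) : InfOpenPathFromRel G.Adj (domanyTrajE G A B ω n) x := by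
  obtain ⟨ρ, hρ, hρ0, hρ1⟩ := exists_openRay_of_rayEvent hray
  have hωx : ω x = true := by simpa [hρ0, hx] using hρ.plus 0
  refine hρ.infOpenPathFromRel hpart hA hx hρ0 (J := (G.neighborFinset x).erase (ρ 1))
    (Finset.notMem_erase _ _) (fun k => ?_) hn
  have h := hesc (ρ 1) hρ1 k
  rwa [escapeEvent, Set.mem_ofPred_eq, ← hωx, Function.update_eq_self] at h

lemma exists_rayEvent_of_infOpenPathFromRel (hpart : ∀ v, v ∈ A ↔ v ∉ B)
    (h : InfOpenPathFromRel (BAdj G A B) ω x) :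
    ∃ a ∈ G.neighborFinset x, ∀ J, a ∈ J → ∀ k, ω ∈ rayEvent G A x J k := by
  obtain ⟨ρ, hρ, hρ0⟩ := exists_openRay hpart h
  exact ⟨ρ 1, (G.mem_neighborFinset x _).2 (hρ0 ▸ hρ.adj 0),
    fun J hJ k => hρ.mem_rayEvent hρ0 hJ k⟩

open Classical in
lemma sq_le_measure_escapeEvent (hdeg : ∀ v, G.degree v = 3)
    (hA : ∀ ⦃u v⦄, G.Adj u v → (u ∈ A ↔ v ∉ A)) (hx : x ∉ A) {a : V}
    (ha : a ∈ G.neighborFinset x) (hp : 1 / 3 ≤ p) (hp1 : p ≤ 1)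
    (hP : ∀ (s : Finset V) (f : V → Bool), P {ω | ∀ v ∈ s, ω v = f v} =
      ∏ v ∈ s, (if f v then ENNReal.ofReal p else ENNReal.ofReal (1 - p))) (k : ℕ) :
    ENNReal.ofReal (p ^ 2) ≤ P (escapeEvent G A x ((G.neighborFinset x).erase a) k) :=
  (ENNReal.ofReal_le_ofReal (sq_le_escapeProb hdeg hA hx (Finset.erase_subset _ _)
    ((Finset.card_erase_of_mem ha).trans (congrArg (· - 1) (hdeg x)))
    (Finset.notMem_erase x _) subset_rfl hp hp1)).trans
    (ofReal_escapeProb_le (by linarith) hp1 hP (Finset.notMem_erase x _))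

open Classical in
lemma three_mul_pow_six_le_measure_escapeEvent (hdeg : ∀ v, G.degree v = 3)
    (hA : ∀ ⦃u v⦄, G.Adj u v → (u ∈ A ↔ v ∉ A)) (hx : x ∉ A) {a : V}
    (ha : a ∈ G.neighborFinset x) (hp : 1 / 4 ≤ p) (hp1 : p ≤ 1 / 3)
    (hP : ∀ (s : Finset V) (f : V → Bool), P {ω | ∀ v ∈ s, ω v = f v} =
      ∏ v ∈ s, (if f v then ENNReal.ofReal p else ENNReal.ofReal (1 - p))) (k : ℕ) :
    ENNReal.ofReal (3 * p ^ 6) ≤ P (escapeEvent G A x ((G.neighborFinset x).erase a) k) :=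
  (ENNReal.ofReal_le_ofReal (three_mul_pow_six_le_escapeProb hdeg hA hx (Finset.erase_subset _ _)
    ((Finset.card_erase_of_mem ha).trans (congrArg (· - 1) (hdeg x)))
    (Finset.notMem_erase x _) subset_rfl hp hp1)).trans
    (ofReal_escapeProb_le (by linarith) (by linarith) hP (Finset.notMem_erase x _))

lemma pow_six_mul_le_of_third_le [IsProbabilityMeasure P] (hdeg : ∀ v, G.degree v = 3)
    (hpart : ∀ v, v ∈ A ↔ v ∉ B) (hA : ∀ ⦃u v⦄, G.Adj u v → (u ∈ A ↔ v ∉ A)) (hx : x ∉ A)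
    (hp : 1 / 3 ≤ p) (hp1 : p ≤ 1)
    (hP : ∀ (s : Finset V) (f : V → Bool), P {ω | ∀ v ∈ s, ω v = f v} =
      ∏ v ∈ s, (if f v then ENNReal.ofReal p else ENNReal.ofReal (1 - p)))
    {n : ℕ∞} (hn : 1 ≤ n) :
    ENNReal.ofReal (p ^ 6) * P {ω | InfOpenPathFromRel (BAdj G A B) ω x} ≤
      P {ω | InfOpenPathFromRel G.Adj (domanyTrajE G A B ω n) x} := by
  classical
  have hp0 : 0 ≤ p := by linarith
  obtain ⟨a, b, c, -, -, -, hN⟩ := Finset.card_eq_three.1 (hdeg x)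
  let E : V → ℕ → Set (V → Bool) := fun a => escapeEvent G A x ((G.neighborFinset x).erase a)
  have hE : ∀ a k, IncCylinder (E a k) := fun a => incCylinder_escapeEvent
  have hle : ∀ k, ENNReal.ofReal (p ^ 6) ≤ P (E a k ∩ (E b k ∩ E c k)) := by
    intro k
    have h : ∀ a ∈ G.neighborFinset x, ENNReal.ofReal (p ^ 2) ≤ P (E a k) := fun a ha =>
      sq_le_measure_escapeEvent hdeg hA hx ha hp hp1 hP k
    calc ENNReal.ofReal (p ^ 6)
        = ENNReal.ofReal (p ^ 2) * (ENNReal.ofReal (p ^ 2) * ENNReal.ofReal (p ^ 2)) := by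
          rw [← ENNReal.ofReal_mul (by positivity), ← ENNReal.ofReal_mul (by positivity)]
          ring_nf
      _ ≤ P (E a k) * (P (E b k) * P (E c k)) :=
          mul_le_mul' (h a (by simp [hN])) (mul_le_mul' (h b (by simp [hN])) (h c (by simp [hN])))
      _ ≤ P (E a k) * P (E b k ∩ E c k) :=
          mul_le_mul' le_rfl ((hE b k).mul_le hp0 hp1 hP (hE c k))
      _ ≤ P (E a k ∩ (E b k ∩ E c k)) := (hE a k).mul_le hp0 hp1 hP ((hE b k).inter (hE c k))
  refine (mul_le_mul' le_rfl (measure_mono ?_)).trans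
    ((mul_measure_iInter_le (C := fun k => E a k ∩ (E b k ∩ E c k))
      (D := rayEvent G A x (G.neighborFinset x)) hp0 hp1 hP
      (fun k l hkl => Set.inter_subset_inter (escapeEvent_antitone hkl)
        (Set.inter_subset_inter (escapeEvent_antitone hkl) (escapeEvent_antitone hkl)))
      rayEvent_antitone (fun k => (hE a k).inter ((hE b k).inter (hE c k)))
      incCylinder_rayEvent hle).trans (measure_mono ?_))
  · intro ω hω
    obtain ⟨a, ha, h⟩ := exists_rayEvent_of_infOpenPathFromRel hpart hω
    exact Set.mem_iInter.2 (h _ ha)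
  · intro ω hω
    rw [Set.mem_iInter] at hω
    refine infOpenPathFromRel_of_rayEvent hpart hA hx (fun k => (hω k).2) (fun d hd k => ?_) hn
    rw [hN] at hd
    simp only [Finset.mem_insert, Finset.mem_singleton] at hd
    rcases hd with rfl | rfl | rfl
    · exact (hω k).1.1
    · exact (hω k).1.2.1
    · exact (hω k).1.2.2

lemma pow_six_mul_le_of_le_third [IsProbabilityMeasure P] (hdeg : ∀ v, G.degree v = 3)
    (hpart : ∀ v, v ∈ A ↔ v ∉ B) (hA : ∀ ⦃u v⦄, G.Adj u v → (u ∈ A ↔ v ∉ A)) (hx : x ∉ A)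
    (hp : 1 / 4 ≤ p) (hp1 : p ≤ 1 / 3)
    (hP : ∀ (s : Finset V) (f : V → Bool), P {ω | ∀ v ∈ s, ω v = f v} =
      ∏ v ∈ s, (if f v then ENNReal.ofReal p else ENNReal.ofReal (1 - p)))
    {n : ℕ∞} (hn : 1 ≤ n) :
    ENNReal.ofReal (p ^ 6) * P {ω | InfOpenPathFromRel (BAdj G A B) ω x} ≤
      P {ω | InfOpenPathFromRel G.Adj (domanyTrajE G A B ω n) x} := by
  classical
  have hp0 : 0 ≤ p := by linarith
  set S := {ω | InfOpenPathFromRel G.Adj (domanyTrajE G A B ω n) x}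
  have hray : ∀ a ∈ G.neighborFinset x,
      ENNReal.ofReal (3 * p ^ 6) * P (⋂ k, rayEvent G A x {a} k) ≤ P S := by
    intro a ha
    refine (mul_measure_iInter_le hp0 (by linarith) hP escapeEvent_antitone rayEvent_antitone
      incCylinder_escapeEvent incCylinder_rayEvent
      (three_mul_pow_six_le_measure_escapeEvent hdeg hA hx ha hp hp1 hP)).trans
      (measure_mono fun ω hω => ?_)
    rw [Set.mem_iInter] at hω
    refine infOpenPathFromRel_of_rayEvent hpart hA hx (fun k => (hω k).2) (fun d hd k => ?_) hn
    rw [Finset.mem_singleton.1 hd]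
    exact (hω k).1
  have hcov : {ω | InfOpenPathFromRel (BAdj G A B) ω x} ⊆
      ⋃ a ∈ G.neighborFinset x, ⋂ k, rayEvent G A x {a} k := by
    intro ω hω
    obtain ⟨a, ha, h⟩ := exists_rayEvent_of_infOpenPathFromRel hpart hω
    exact Set.mem_biUnion ha (Set.mem_iInter.2 (h _ (Finset.mem_singleton_self a)))
  have h3 : ENNReal.ofReal (3 * p ^ 6) = 3 * ENNReal.ofReal (p ^ 6) := by
    rw [ENNReal.ofReal_mul (by norm_num)]
    norm_num
  have hsum : 3 * (ENNReal.ofReal (p ^ 6) * P {ω | InfOpenPathFromRel (BAdj G A B) ω x}) ≤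
      3 * P S := by
    calc 3 * (ENNReal.ofReal (p ^ 6) * P {ω | InfOpenPathFromRel (BAdj G A B) ω x})
        ≤ ENNReal.ofReal (3 * p ^ 6) *
            ∑ a ∈ G.neighborFinset x, P (⋂ k, rayEvent G A x {a} k) := by
          rw [h3, mul_assoc]
          gcongr
          exact (measure_mono hcov).trans (measure_biUnion_finset_le _ _)
      _ = ∑ a ∈ G.neighborFinset x,
            ENNReal.ofReal (3 * p ^ 6) * P (⋂ k, rayEvent G A x {a} k) := Finset.mul_sum _ _ _
      _ ≤ (G.neighborFinset x).card • P S := Finset.sum_le_card_nsmul _ _ _ hray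
      _ = 3 * P S := by
          rw [show (G.neighborFinset x).card = 3 from hdeg x, nsmul_eq_mul, Nat.cast_ofNat]
  exact (ENNReal.mul_le_mul_iff_right (by norm_num) (by norm_num)).1 hsum

end LowerBound

/-- for the Domany model with i.i.d. Bernoulli(p) initial condition, for
every time `n ∈ [1,∞]` and every `x ∈ B`, `θ_x(p,n) ≥ p⁶ · θ_x(p)`, where `θ_x(p,n)` is
the probability that `x` lies in an infinite plus `H`-path at time `n` and `θ_x(p)` is
the probability that `x` lies in an infinite plus `B`-path (triangular lattice) at
time 0. -/
theorem domany_theta_lower_bound {V : Type*} [Countable V]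
    (G : SimpleGraph V) [G.LocallyFinite] (A B : Set V)
    (hdeg : ∀ v, G.degree v = 3)
    (hpart : ∀ v, v ∈ A ↔ v ∉ B)
    (hbip : ∀ ⦃x y⦄, G.Adj x y → (x ∈ A ↔ y ∈ B))
    (p : ℝ) (hp0 : 0 ≤ p) (hp1 : p ≤ 1)
    (P : Measure (V → Bool)) [IsProbabilityMeasure P]
    (hP : ∀ (s : Finset V) (f : V → Bool),
      P {ω | ∀ v ∈ s, ω v = f v} =
        ∏ v ∈ s, (if f v then ENNReal.ofReal p else ENNReal.ofReal (1 - p)))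
    (x : V) (hx : x ∈ B) :
    ∀ n : ℕ∞, 1 ≤ n →
      ENNReal.ofReal (p ^ 6) *
          P {σ0 : V → Bool | InfOpenPathFromRel (BAdj G A B) σ0 x} ≤
        P {σ0 : V → Bool |
            InfOpenPathFromRel G.Adj (domanyTrajE G A B σ0 n) x} := by
  intro n hn
  have hx' : x ∉ A := fun h => (hpart x).1 h hx
  have hA : ∀ ⦃u v⦄, G.Adj u v → (u ∈ A ↔ v ∉ A) := fun u v huv => by
    rw [hbip huv, hpart v, not_not]
  rcases lt_or_ge p (1 / 4) with hp4 | hp4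
  · have h0 : P {σ0 : V → Bool | InfOpenPathFromRel (BAdj G A B) σ0 x} = 0 := by
      refine measure_mono_null (fun ω hω => ?_)
        (measure_iInter_rayEvent_eq_zero (J := G.neighborFinset x) hdeg hA hx' hp0 hp4 hP)
      obtain ⟨a, ha, h⟩ := exists_rayEvent_of_infOpenPathFromRel hpart hω
      exact Set.mem_iInter.2 (h _ ha)
    rw [h0, mul_zero]
    exact zero_le
  · rcases le_total p (1 / 3) with hp3 | hp3
    · exact pow_six_mul_le_of_le_third hdeg hpart hA hx' hp4 hp3 hP hn
    · exact pow_six_mul_le_of_third_le hdeg hpart hA hx' hp3 hp1 hP hn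
end
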